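/- For all 1 ≤ i ≤ j ≤ n−1 and −θ(j+1) ≤ s ≤ θ(j+1)−1, setting F_{i,j+1}^{≥s} = Σ_{r=s}^{θ(j+1)−1} F_{i,j}^{↑r_+} m_{θ(j+1)}^r (so that F_{i,j+1}^{≥−θ(j+1)} = F_{i,j+1} and F_{i,j+1}^{≥θ(j+1)} = 0), the following pentagon-type identity holds in A⟦t⟧: ψ_{j−i+1}(E_{i,j} ⊗ F_{i,j}^{↑s_+}) · ψ_{j−i+2}(E_{i,j+1} ⊗ F_{i,j+1}^{≥s}) · ψ_1(E_{j+1} ⊗ m_{θ(j+1)}^s) = ψ_1(E_{j+1} ⊗ m_{θ(j+1)}^s) · ψ_{j−i+1}(E_{i,j} ⊗ F_{i,j}^{↑s_+}) · ψ_{j−i+2}(E_{i,j+1} ⊗ F_{i,j+1}^{≥s+1}). -/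

import Mathlib

noncomputable section

/-- The ground field `𝕂 = ℂ(q)`, the field of rational functions over `ℂ`. -/
abbrev Kq : Type := RatFunc ℂ

/-- The formal variable `q ∈ ℂ(q)`. -/
def qq : Kq := RatFunc.X

/-- `𝐢 = √−1 ∈ ℂ`, viewed as a constant in `𝕂 = ℂ(q)`. -/
def ii : Kq := RatFunc.C Complex.I

/-- `θ(i) = n + 1 − i`. -/
def th (n : ℕ) (i : ℤ) : ℤ := (n : ℤ) + 1 - i

/-- Labels for the vertices of the `𝒟ₙ`-quiver: `V i r` stands for `V_{i,r}`
(the canonical labels), and `C i` stands for the central vertex `Λ_{i,0}`. -/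
inductive DnLabel : Type
  | V : ℤ → ℤ → DnLabel
  | C : ℤ → DnLabel
deriving DecidableEq

/-- Validity of a label for given rank `n`: `V i r` requires `1 ≤ i ≤ n`, `−i ≤ r ≤ i`;
`C i` requires `1 ≤ i ≤ n`.  There are `n² + 3n` valid labels. -/
def DnLabel.valid (n : ℕ) : DnLabel → Prop
  | .V i r => 1 ≤ i ∧ i ≤ (n : ℤ) ∧ -i ≤ r ∧ r ≤ i
  | .C i => 1 ≤ i ∧ i ≤ (n : ℤ)

instance (n : ℕ) (v : DnLabel) : Decidable (v.valid n) := by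
  cases v <;> unfold DnLabel.valid <;> infer_instance

/-- The vertex set of the `𝒟ₙ`-quiver. -/
def DnVertex (n : ℕ) := {v : DnLabel // v.valid n}

/-- The canonical label of the vertex `Λ_{i,r}`, using the identifications
`Λ_{a,b} = V_{θ(b),−θ(a)}` for `b > 0` and `Λ_{a,b} = V_{θ(−b),θ(a)}` for `b < 0`. -/
def Lam (n : ℕ) (i r : ℤ) : DnLabel :=
  if 0 < r then .V (th n r) (-(th n i))
  else if r < 0 then .V (th n (-r)) (th n i)
  else .C i

/-- The list of arrows `(source, target, doubled weight)` of the `𝒟ₙ`-quiver, obtained by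
amalgamating two copies of the Fock–Goncharov `(n+1)`-triangle quiver along two pairs of
sides.  Solid (weight `1`) arrows get doubled weight `2`, dashed (weight `1/2`) arrows get
doubled weight `1`.  The families are: the horizontal `V_i`- and `Λ_i`-path arrows, the
dashed boundary arrows along the two frozen columns, and, for each `1 ≤ i < n`, the
oriented cycle `V_{i,0} → V_{i+1,−1} → ⋯ → V_{n,i−n} → Λ_{i,0} → V_{n,n−i} → ⋯ → V_{i+1,1} → V_{i,0}`
through the central column. -/
def dnArrows (n : ℕ) : List (DnLabel × DnLabel × ℤ) :=
  ((List.range n).flatMap fun i0 =>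
    (List.range (2 * i0 + 2)).map fun k =>
      (DnLabel.V ((i0 : ℤ) + 1) (-((i0 : ℤ) + 1) + k),
       DnLabel.V ((i0 : ℤ) + 1) (-((i0 : ℤ) + 1) + k + 1), 2))
  ++ ((List.range n).flatMap fun i0 =>
    (List.range (2 * i0 + 2)).map fun k =>
      (Lam n ((i0 : ℤ) + 1) (-((i0 : ℤ) + 1) + k),
       Lam n ((i0 : ℤ) + 1) (-((i0 : ℤ) + 1) + k + 1), 2))
  ++ ((List.range (n - 1)).map fun i0 =>
      (DnLabel.V ((i0 : ℤ) + 1) (-((i0 : ℤ) + 1)),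
       DnLabel.V ((i0 : ℤ) + 2) (-((i0 : ℤ) + 2)), 1))
  ++ ((List.range (n - 1)).map fun i0 =>
      (DnLabel.V ((i0 : ℤ) + 2) ((i0 : ℤ) + 2),
       DnLabel.V ((i0 : ℤ) + 1) ((i0 : ℤ) + 1), 1))
  ++ ((List.range (n - 1)).flatMap fun i0 =>
      (((List.range (n - 1 - i0)).map fun k =>
          (DnLabel.V ((i0 : ℤ) + 1 + k) (-(k : ℤ)),
           DnLabel.V ((i0 : ℤ) + 2 + k) (-(k : ℤ) - 1), 2))
        ++ [(DnLabel.V (n : ℤ) ((i0 : ℤ) + 1 - n), DnLabel.C ((i0 : ℤ) + 1), 2),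
            (DnLabel.C ((i0 : ℤ) + 1), DnLabel.V (n : ℤ) ((n : ℤ) - (i0 + 1)), 2)]
        ++ ((List.range (n - 1 - i0)).map fun k =>
          (DnLabel.V ((i0 : ℤ) + 2 + k) ((k : ℤ) + 1),
           DnLabel.V ((i0 : ℤ) + 1 + k) (k : ℤ), 2))))

/-- The doubled exchange matrix `2·ε_{uv}` of the `𝒟ₙ`-quiver. -/
def eps2 (n : ℕ) (u v : DnLabel) : ℤ :=
  ((dnArrows n).map fun a =>
    (if a.1 = u ∧ a.2.1 = v then a.2.2 else 0)
      - (if a.1 = v ∧ a.2.1 = u then a.2.2 else 0)).sum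

/-- The defining relations of the quantum torus algebra `𝒟ₙ`: generators `X_v^{±1}`
(`Sum.inl v` is `X_v`, `Sum.inr v` is `X_v⁻¹`) with `X_u X_v = q^{2 ε_{vu}} X_v X_u`. -/
inductive DnRel (n : ℕ) :
    FreeAlgebra Kq (DnVertex n ⊕ DnVertex n) →
      FreeAlgebra Kq (DnVertex n ⊕ DnVertex n) → Prop
  | comm (u v : DnVertex n) :
      DnRel n (FreeAlgebra.ι Kq (Sum.inl u) * FreeAlgebra.ι Kq (Sum.inl v))
        ((qq ^ eps2 n v.1 u.1) • (FreeAlgebra.ι Kq (Sum.inl v) * FreeAlgebra.ι Kq (Sum.inl u)))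
  | mul_inv (v : DnVertex n) :
      DnRel n (FreeAlgebra.ι Kq (Sum.inl v) * FreeAlgebra.ι Kq (Sum.inr v)) 1
  | inv_mul (v : DnVertex n) :
      DnRel n (FreeAlgebra.ι Kq (Sum.inr v) * FreeAlgebra.ι Kq (Sum.inl v)) 1

/-- The quantum torus algebra `𝒟ₙ`. -/
abbrev Dtorus (n : ℕ) := RingQuot (DnRel n)

/-- The cluster variable `X_v ∈ 𝒟ₙ` attached to a label (junk value `1` on invalid labels). -/
def Xg (n : ℕ) (v : DnLabel) : Dtorus n :=
  if h : v.valid n then RingQuot.mkAlgHom Kq (DnRel n) (FreeAlgebra.ι Kq (Sum.inl ⟨v, h⟩)) else 1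

/-- The inverse cluster variable `X_v⁻¹ ∈ 𝒟ₙ` (junk value `1` on invalid labels). -/
def Xinv (n : ℕ) (v : DnLabel) : Dtorus n :=
  if h : v.valid n then RingQuot.mkAlgHom Kq (DnRel n) (FreeAlgebra.ι Kq (Sum.inr ⟨v, h⟩)) else 1

/-- The ordered product `X_{V_{i,−i}} X_{V_{i,1−i}} ⋯ X_{V_{i,r}}`. -/
def Vprod (n : ℕ) (i r : ℤ) : Dtorus n :=
  ((List.range (r + i + 1).toNat).map fun k => Xg n (.V i (-i + k))).prod

/-- The ordered product `X_{Λ_{i,−i}} X_{Λ_{i,1−i}} ⋯ X_{Λ_{i,r}}`. -/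
def Lprod (n : ℕ) (i r : ℤ) : Dtorus n :=
  ((List.range (r + i + 1).toNat).map fun k => Xg n (Lam n i (-i + k))).prod

/-- `w_i^r = 𝐢 q^{i+r} X_{V_{i,−i}} X_{V_{i,1−i}} ⋯ X_{V_{i,r}}`. -/
def ww (n : ℕ) (i r : ℤ) : Dtorus n := (ii * qq ^ (i + r)) • Vprod n i r

/-- `m_i^r = 𝐢 q^{i+r} X_{Λ_{i,−i}} X_{Λ_{i,1−i}} ⋯ X_{Λ_{i,r}}`. -/
def mm (n : ℕ) (i r : ℤ) : Dtorus n := (ii * qq ^ (i + r)) • Lprod n i r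


/-- `E_i = Σ_{r=−i}^{i−1} w_i^r ∈ 𝒟ₙ`, the image of the Chevalley generator `E_i`. -/
def Ev (n : ℕ) (i : ℤ) : Dtorus n := ∑ r ∈ Finset.Icc (-i) (i - 1), ww n i r

/-- `F_j = Σ_{r=−θ(j)}^{θ(j)−1} m_{θ(j)}^r ∈ 𝒟ₙ`, the image of the Chevalley generator `F_j`. -/
def Fv (n : ℕ) (j : ℤ) : Dtorus n :=
  ∑ r ∈ Finset.Icc (-(th n j)) (th n j - 1), mm n (th n j) r

/-- Auxiliary recursion: `EEaux n i k = E_{i,i+k}`. -/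
def EEaux (n : ℕ) (i : ℤ) : ℕ → Dtorus n
  | 0 => Ev n i
  | k + 1 => (qq - qq⁻¹)⁻¹ •
      (EEaux n i k * Ev n (i + k + 1) - qq • (Ev n (i + k + 1) * EEaux n i k))

/-- The quantum root vector `E_{i,j}`, defined by `E_{i,i} = E_i` and
`E_{i,j} = (E_{i,j−1}E_j − qE_jE_{i,j−1})/(q−q^{−1})`. -/
def EE (n : ℕ) (i j : ℤ) : Dtorus n := EEaux n i (j - i).toNat

/-- Auxiliary recursion: `FFaux n i k = F_{i,i+k}`. -/
def FFaux (n : ℕ) (i : ℤ) : ℕ → Dtorus n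
  | 0 => Fv n i
  | k + 1 => (qq - qq⁻¹)⁻¹ •
      (Fv n (i + k + 1) * FFaux n i k - qq⁻¹ • (FFaux n i k * Fv n (i + k + 1)))

/-- The quantum root vector `F_{i,j}`, defined by `F_{i,i} = F_i` and
`F_{i,j} = (F_jF_{i,j−1} − q^{−1}F_{i,j−1}F_j)/(q−q^{−1})`. -/
def FF (n : ℕ) (i j : ℤ) : Dtorus n := FFaux n i (j - i).toNat

open Classical in
/-- The decomposition `x = x^− + x^+` with `y x^± = q^{±1} x^± y`; it is unique when it
exists (the first component is `x^−`, the second is `x^+`; junk value otherwise). -/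
def decompPM (n : ℕ) (y x : Dtorus n) : Dtorus n × Dtorus n :=
  if h : ∃ p : Dtorus n × Dtorus n,
      x = p.1 + p.2 ∧ y * p.1 = qq⁻¹ • (p.1 * y) ∧ y * p.2 = qq • (p.2 * y)
  then h.choose else (x, 0)

/-- The components `E_{i,j}^{↑s_∓}` of `E_{i,j}` with respect to `w_{j+1}^s`. -/
def Eup (n : ℕ) (i j s : ℤ) : Dtorus n × Dtorus n := decompPM n (ww n (j + 1) s) (EE n i j)

/-- The components `E_{i,j}^{↓r_∓}` of `E_{i,j}` with respect to `w_{i−1}^r`. -/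
def Edown (n : ℕ) (i j r : ℤ) : Dtorus n × Dtorus n := decompPM n (ww n (i - 1) r) (EE n i j)

/-- The components `F_{i,j}^{↑s_∓}` of `F_{i,j}` with respect to `m_{θ(j+1)}^s`. -/
def Fup (n : ℕ) (i j s : ℤ) : Dtorus n × Dtorus n :=
  decompPM n (mm n (th n (j + 1)) s) (FF n i j)

/-- The components `F_{i,j}^{↓r_∓}` of `F_{i,j}` with respect to `m_{θ(i−1)}^r`. -/
def Fdown (n : ℕ) (i j r : ℤ) : Dtorus n × Dtorus n :=
  decompPM n (mm n (th n (i - 1)) r) (FF n i j)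

open scoped TensorProduct

/-- `A = 𝒟ₙ ⊗_𝕂 𝒟ₙ`. -/
abbrev AA (n : ℕ) := Dtorus n ⊗[Kq] Dtorus n

/-- `∏_{j=1}^{m} (q^{2j} − 1)`. -/
def qfac (m : ℕ) : Kq := ∏ j ∈ Finset.range m, (qq ^ (2 * (j + 1)) - 1)

/-- The quantum dilogarithm `ψ_h(x) = Ψ^q(−t^h x) ∈ B⟦t⟧`, i.e. the t-adically convergent
infinite product `∏_{k=0}^{∞} (1 − q^{2k+1} t^h x)^{−1}`; explicitly it is the
`q`-exponential series `Σ_{m≥0} (−1)^m q^m x^m t^{hm} / ∏_{j=1}^{m}(q^{2j} − 1)`,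
the unique solution with constant term `1` of `Ψ^q(q²z) = (1+qz)Ψ^q(z)` at `z = −t^h x`. -/
def psiH {B : Type*} [Ring B] [Algebra Kq B] (h : ℕ) (x : B) : PowerSeries B :=
  PowerSeries.mk fun d =>
    if 0 < h ∧ h ∣ d then
      (((-1 : Kq) ^ (d / h) * qq ^ (d / h) / qfac (d / h)) • x ^ (d / h))
    else 0

/-- `F_{i,j}^{≥s} = Σ_{r=s}^{θ(j)−1} F_{i,j−1}^{↑r_+} m_{θ(j)}^r`  (so that
`F_{i,j}^{≥−θ(j)} = F_{i,j}` and `F_{i,j}^{≥θ(j)} = 0`). -/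
def FgeS (n : ℕ) (i j s : ℤ) : Dtorus n :=
  ∑ r ∈ Finset.Icc s (th n j - 1), (Fup n i (j - 1) r).2 * mm n (th n j) r

/-- The total doubled weight of the arrows from `u` to `v`. -/
def arrowWeight (n : ℕ) (u v : DnLabel) : ℤ :=
  ((dnArrows n).map fun a => if a.1 = u ∧ a.2.1 = v then a.2.2 else 0).sum

theorem eps2_eq_sub (n : ℕ) (u v : DnLabel) :
    eps2 n u v = arrowWeight n u v - arrowWeight n v u := by
  unfold eps2 arrowWeight
  induction dnArrows n with
  | nil => simp
  | cons a l ih => simp only [List.map_cons, List.sum_cons, ih]; ring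

theorem sum_map_range_ite {N : ℕ} {P : ℕ → Prop} [DecidablePred P] {Q : Prop} [Decidable Q]
    (w : ℤ) (huniq : ∀ i i', P i → P i' → i = i') (hQ : Q ↔ ∃ i, i < N ∧ P i) :
    ((List.range N).map fun i => if P i then w else 0).sum = if Q then w else 0 := by
  have h : ((List.range N).map fun i => if P i then w else 0).sum
      = ∑ i ∈ Finset.range N, if P i then w else 0 := by
    induction N generalizing Q with
    | zero => simp
    | succ N ih => rw [List.range_succ, Finset.sum_range_succ,
        ← ih (Q := ∃ i, i < N ∧ P i) (Iff.rfl)]; simp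
  rw [h]
  by_cases hq : Q
  · obtain ⟨i, hi, hp⟩ := hQ.1 hq
    rw [if_pos hq, Finset.sum_eq_single i, if_pos hp]
    · intro k _ hk
      exact if_neg fun hpk => hk (huniq _ _ hpk hp)
    · intro h'
      exact absurd (Finset.mem_range.2 hi) h'
  · rw [if_neg hq]
    refine Finset.sum_eq_zero fun k hk => if_neg fun hp => hq (hQ.2 ⟨k, Finset.mem_range.1 hk, hp⟩)

theorem sum_flatMap_range_ite {N : ℕ} {M : ℕ → ℕ} {P : ℕ → ℕ → Prop}
    [∀ i, DecidablePred (P i)] {Q : Prop} [Decidable Q] (w : ℤ)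
    (huniq : ∀ i k i' k', P i k → P i' k' → i = i' ∧ k = k')
    (hQ : Q ↔ ∃ i k, i < N ∧ k < M i ∧ P i k) :
    ((List.range N).map fun i =>
      ((List.range (M i)).map fun k => if P i k then w else 0).sum).sum = if Q then w else 0 := by
  classical
  have h : ∀ i, ((List.range (M i)).map fun k => if P i k then w else 0).sum
      = if ∃ k, k < M i ∧ P i k then w else 0 := fun i =>
    sum_map_range_ite w (fun k k' h h' => (huniq _ _ _ _ h h').2) Iff.rfl
  simp only [h]
  refine sum_map_range_ite w ?_ ?_
  · rintro i i' ⟨k, _, h⟩ ⟨k', _, h'⟩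
    exact (huniq _ _ _ _ h h').1
  · rw [hQ]
    constructor
    · rintro ⟨i, k, h1, h2, h3⟩; exact ⟨i, h1, k, h2, h3⟩
    · rintro ⟨i, h1, k, h2, h3⟩; exact ⟨i, k, h1, h2, h3⟩

theorem arrowWeight_eq (n : ℕ) (u v : DnLabel) :
    arrowWeight n u v =
      ((List.range n).map fun (i0 : ℕ) => ((List.range (2 * i0 + 2)).map fun (k : ℕ) =>
        if DnLabel.V ((i0 : ℤ) + 1) (-((i0 : ℤ) + 1) + k) = u ∧
          DnLabel.V ((i0 : ℤ) + 1) (-((i0 : ℤ) + 1) + k + 1) = v then (2 : ℤ) else 0).sum).sum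
      + ((List.range n).map fun (i0 : ℕ) => ((List.range (2 * i0 + 2)).map fun (k : ℕ) =>
        if Lam n ((i0 : ℤ) + 1) (-((i0 : ℤ) + 1) + k) = u ∧
          Lam n ((i0 : ℤ) + 1) (-((i0 : ℤ) + 1) + k + 1) = v then (2 : ℤ) else 0).sum).sum
      + ((List.range (n - 1)).map fun (i0 : ℕ) =>
        if DnLabel.V ((i0 : ℤ) + 1) (-((i0 : ℤ) + 1)) = u ∧
          DnLabel.V ((i0 : ℤ) + 2) (-((i0 : ℤ) + 2)) = v then (1 : ℤ) else 0).sum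
      + ((List.range (n - 1)).map fun (i0 : ℕ) =>
        if DnLabel.V ((i0 : ℤ) + 2) ((i0 : ℤ) + 2) = u ∧
          DnLabel.V ((i0 : ℤ) + 1) ((i0 : ℤ) + 1) = v then (1 : ℤ) else 0).sum
      + (((List.range (n - 1)).map fun (i0 : ℕ) => ((List.range (n - 1 - i0)).map fun (k : ℕ) =>
          if DnLabel.V ((i0 : ℤ) + 1 + k) (-(k : ℤ)) = u ∧
            DnLabel.V ((i0 : ℤ) + 2 + k) (-(k : ℤ) - 1) = v then (2 : ℤ) else 0).sum).sum
        + ((List.range (n - 1)).map fun (i0 : ℕ) =>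
          if DnLabel.V (n : ℤ) ((i0 : ℤ) + 1 - n) = u ∧
            DnLabel.C ((i0 : ℤ) + 1) = v then (2 : ℤ) else 0).sum
        + ((List.range (n - 1)).map fun (i0 : ℕ) =>
          if DnLabel.C ((i0 : ℤ) + 1) = u ∧
            DnLabel.V (n : ℤ) ((n : ℤ) - (i0 + 1)) = v then (2 : ℤ) else 0).sum
        + ((List.range (n - 1)).map fun (i0 : ℕ) => ((List.range (n - 1 - i0)).map fun (k : ℕ) =>
          if DnLabel.V ((i0 : ℤ) + 2 + k) ((k : ℤ) + 1) = u ∧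
            DnLabel.V ((i0 : ℤ) + 1 + k) (k : ℤ) = v then (2 : ℤ) else 0).sum).sum) := by
  have hmap : ∀ (N : ℕ) (f g : ℕ → ℤ), ((List.range N).map fun i => f i + g i).sum
      = ((List.range N).map f).sum + ((List.range N).map g).sum := by
    intro N f g
    exact List.sum_map_add
  have hflat : ∀ (N : ℕ) (f : ℕ → List (DnLabel × DnLabel × ℤ)) (g : DnLabel × DnLabel × ℤ → ℤ),
      (((List.range N).flatMap f).map g).sum
        = ((List.range N).map fun i => ((f i).map g).sum).sum := by
    intro N f g
    rw [List.map_flatMap]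
    induction List.range N with
    | nil => rfl
    | cons a l ih => simp [List.flatMap_cons, ih]
  have hcast : ∀ l : List ℕ, (do let a ← l; pure (a : ℤ)) = l.map fun a : ℕ => (a : ℤ) :=
    fun l => List.flatMap_pure_eq_map _ l
  unfold arrowWeight dnArrows
  simp only [hcast, List.map_append, List.sum_append, hflat, List.map_map, Function.comp_def,
    List.map_cons, List.map_nil, List.sum_cons, List.sum_nil, add_zero, hmap]
  simp only [add_assoc]

theorem Lam_eq_V_iff (n : ℕ) (i r a b : ℤ) : Lam n i r = .V a b ↔
    (0 < r ∧ a = n + 1 - r ∧ b = i - n - 1) ∨ (r < 0 ∧ a = n + 1 + r ∧ b = n + 1 - i) := by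
  unfold Lam th
  split_ifs <;> simp <;> omega

theorem Lam_eq_C_iff (n : ℕ) (i r a : ℤ) : Lam n i r = .C a ↔ r = 0 ∧ a = i := by
  unfold Lam th
  split_ifs <;> simp <;> omega

theorem arrowWeight_V_V (n : ℕ) (a b c d : ℤ) :
    arrowWeight n (.V a b) (.V c d) =
      (if 1 ≤ a ∧ a ≤ n ∧ -a ≤ b ∧ b < a ∧ c = a ∧ d = b + 1 then 2 else 0)
      + (if (c = a - 1 ∧ d = b ∧ b ≤ -1 ∧ a ≤ n ∧ 1 - b ≤ a ∧ -b ≤ n) ∨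
          (c = a + 1 ∧ d = b ∧ 1 ≤ b ∧ b ≤ a ∧ a < n) then 2 else 0)
      + (if 1 ≤ a ∧ a < n ∧ b = -a ∧ c = a + 1 ∧ d = -a - 1 then 1 else 0)
      + (if 1 ≤ c ∧ c < n ∧ d = c ∧ a = c + 1 ∧ b = c + 1 then 1 else 0)
      + ((if c = a + 1 ∧ d = b - 1 ∧ b ≤ 0 ∧ 1 ≤ a + b ∧ a < n then 2 else 0)
        + 0 + 0
        + (if a = c + 1 ∧ b = d + 1 ∧ 0 ≤ d ∧ 1 ≤ c - d ∧ c < n then 2 else 0)) := by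
  rw [arrowWeight_eq]
  refine congrArg₂ _ (congrArg₂ _ (congrArg₂ _ (congrArg₂ _ ?_ ?_) ?_) ?_)
    (congrArg₂ _ (congrArg₂ _ (congrArg₂ _ ?_ ?_) ?_) ?_)
  · refine sum_flatMap_range_ite _ ?_ ?_
    · simp only [DnLabel.V.injEq]; omega
    · simp only [DnLabel.V.injEq]
      exact ⟨fun h => ⟨(a - 1).toNat, (b + a).toNat, by omega⟩, fun ⟨i, k, h⟩ => by omega⟩
  · refine sum_flatMap_range_ite _ ?_ ?_
    · simp only [Lam_eq_V_iff]; omega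
    · simp only [Lam_eq_V_iff]
      constructor
      · rintro (h | h)
        · exact ⟨(n + b).toNat, (n + 1 - a + n + 1 + b).toNat, by omega⟩
        · exact ⟨(n - b).toNat, (a - b).toNat, by omega⟩
      · rintro ⟨i, k, h⟩; omega
  · refine sum_map_range_ite _ ?_ ?_
    · simp only [DnLabel.V.injEq]; omega
    · simp only [DnLabel.V.injEq]
      exact ⟨fun h => ⟨(a - 1).toNat, by omega⟩, fun ⟨i, h⟩ => by omega⟩
  · refine sum_map_range_ite _ ?_ ?_
    · simp only [DnLabel.V.injEq]; omega
    · simp only [DnLabel.V.injEq]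
      exact ⟨fun h => ⟨(c - 1).toNat, by omega⟩, fun ⟨i, h⟩ => by omega⟩
  · refine sum_flatMap_range_ite _ ?_ ?_
    · simp only [DnLabel.V.injEq]; omega
    · simp only [DnLabel.V.injEq]
      exact ⟨fun h => ⟨(a + b - 1).toNat, (-b).toNat, by omega⟩, fun ⟨i, k, h⟩ => by omega⟩
  · simp
  · simp
  · refine sum_flatMap_range_ite _ ?_ ?_
    · simp only [DnLabel.V.injEq]; omega
    · simp only [DnLabel.V.injEq]
      exact ⟨fun h => ⟨(c - d - 1).toNat, d.toNat, by omega⟩, fun ⟨i, k, h⟩ => by omega⟩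

theorem arrowWeight_V_C (n : ℕ) (a b i : ℤ) :
    arrowWeight n (.V a b) (.C i) =
      (if a = n ∧ b = n + 1 - i ∧ 1 ≤ i ∧ i ≤ n then 2 else 0)
        + (if a = n ∧ b = i - n ∧ 1 ≤ i ∧ i < n then 2 else 0) := by
  rw [arrowWeight_eq]
  simp only [reduceCtorEq, and_false, if_false, List.map_const', List.sum_replicate,
    smul_zero, add_zero, zero_add]
  refine congrArg₂ _ ?_ ?_
  · refine sum_flatMap_range_ite _ ?_ ?_
    · simp only [Lam_eq_V_iff, Lam_eq_C_iff]; omega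
    · simp only [Lam_eq_V_iff, Lam_eq_C_iff]
      exact ⟨fun h => ⟨(i - 1).toNat, (i - 1).toNat, by omega⟩, fun ⟨i, k, h⟩ => by omega⟩
  · refine sum_map_range_ite _ ?_ ?_
    · simp only [DnLabel.V.injEq, DnLabel.C.injEq]; omega
    · simp only [DnLabel.V.injEq, DnLabel.C.injEq]
      exact ⟨fun h => ⟨(i - 1).toNat, by omega⟩, fun ⟨i, h⟩ => by omega⟩

theorem arrowWeight_C_V (n : ℕ) (i c d : ℤ) :
    arrowWeight n (.C i) (.V c d) =
      (if c = n ∧ d = i - n - 1 ∧ 1 ≤ i ∧ i ≤ n then 2 else 0)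
        + (if c = n ∧ d = n - i ∧ 1 ≤ i ∧ i < n then 2 else 0) := by
  rw [arrowWeight_eq]
  simp only [reduceCtorEq, and_false, false_and, if_false, List.map_const', List.sum_replicate,
    smul_zero, add_zero, zero_add]
  refine congrArg₂ _ ?_ ?_
  · refine sum_flatMap_range_ite _ ?_ ?_
    · simp only [Lam_eq_V_iff, Lam_eq_C_iff]; omega
    · simp only [Lam_eq_V_iff, Lam_eq_C_iff]
      exact ⟨fun h => ⟨(i - 1).toNat, i.toNat, by omega⟩, fun ⟨i, k, h⟩ => by omega⟩
  · refine sum_map_range_ite _ ?_ ?_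
    · simp only [DnLabel.V.injEq, DnLabel.C.injEq]; omega
    · simp only [DnLabel.V.injEq, DnLabel.C.injEq]
      exact ⟨fun h => ⟨(i - 1).toNat, by omega⟩, fun ⟨i, h⟩ => by omega⟩

theorem arrowWeight_C_C (n : ℕ) (i k : ℤ) : arrowWeight n (.C i) (.C k) = 0 := by
  rw [arrowWeight_eq]
  simp only [reduceCtorEq, and_false, false_and, if_false, List.map_const', List.sum_replicate,
    smul_zero, add_zero, zero_add]
  refine (sum_flatMap_range_ite (Q := False) _ ?_ ?_).trans (by simp)
  · simp only [Lam_eq_C_iff]; omega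
  · simp only [Lam_eq_C_iff]
    exact ⟨fun h => h.elim, fun ⟨i, k, h⟩ => by omega⟩

theorem eps2_swap (n : ℕ) (u v : DnLabel) : eps2 n v u = -eps2 n u v := by
  rw [eps2_eq_sub, eps2_eq_sub, neg_sub]

theorem eps2_V_V_same (n : ℕ) {a b d : ℤ} (h1 : 1 ≤ a) (h2 : a ≤ n) (h3 : -a ≤ b) (h4 : b ≤ a)
    (h5 : -a ≤ d) (h6 : d ≤ a) :
    eps2 n (.V a b) (.V a d) = if d = b + 1 then 2 else if b = d + 1 then -2 else 0 := by
  rw [eps2_eq_sub, arrowWeight_V_V, arrowWeight_V_V]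
  rcases (by omega : d = b + 1 ∨ b = d + 1 ∨ (d ≠ b + 1 ∧ b ≠ d + 1)) with h | h | h <;>
    (simp (disch := omega) only [if_pos, if_neg]; norm_num <;> omega)

theorem eps2_V_V_succ (n : ℕ) {a b d : ℤ} (h1 : 1 ≤ a) (h2 : a < n) (h3 : -a ≤ b) (h4 : b ≤ a) :
    eps2 n (.V a b) (.V (a + 1) d) =
      (if d = b - 1 ∧ b ≤ 0 then (if b = -a then 1 else 2) else 0)
      + (if d = b then (if b = 0 then 0 else if b < 0 then -2 else 2) else 0)
      - (if d = b + 1 ∧ 0 ≤ b then (if b = a then 1 else 2) else 0) := by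
  rw [eps2_eq_sub, arrowWeight_V_V, arrowWeight_V_V]
  rcases (by omega : b < 0 ∨ b = 0 ∨ 0 < b) with h | h | h <;>
  rcases (by omega : d = b - 1 ∨ d = b ∨ d = b + 1 ∨ (d ≠ b - 1 ∧ d ≠ b ∧ d ≠ b + 1))
    with h' | h' | h' | h' <;>
  rcases (by omega : b = -a ∨ b = a ∨ (b ≠ -a ∧ b ≠ a)) with h'' | h'' | h'' <;>
    first
    | (exfalso; omega)
    | (simp (disch := omega) only [if_pos, if_neg]; norm_num <;> omega)

theorem eps2_V_V_far (n : ℕ) {a b c d : ℤ} (h1 : a + 2 ≤ c) :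
    eps2 n (.V a b) (.V c d) = 0 := by
  rw [eps2_eq_sub, arrowWeight_V_V, arrowWeight_V_V]
  simp (disch := omega) only [if_neg]
  norm_num

theorem Lam_of_pos (n : ℕ) (i : ℤ) {r : ℤ} (h : 0 < r) :
    Lam n i r = .V (n + 1 - r) (-(n + 1 - i)) := by simp [Lam, th, h]

theorem Lam_of_neg (n : ℕ) (i : ℤ) {r : ℤ} (h : r < 0) :
    Lam n i r = .V (n + 1 - (-r)) (n + 1 - i) := by
  simp [Lam, th, h, h.le]

theorem Lam_zero (n : ℕ) (i : ℤ) : Lam n i 0 = .C i := by simp [Lam]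

theorem arrowWeight_Lam_Lam (n : ℕ) {i r k s : ℤ} (h1 : 1 ≤ i) (h2 : i ≤ n) (h3 : -i ≤ r)
    (h4 : r ≤ i) (h5 : 1 ≤ k) (h6 : k ≤ n) (h7 : -k ≤ s) (h8 : s ≤ k) :
    arrowWeight n (Lam n i r) (Lam n k s) = arrowWeight n (.V i r) (.V k s) := by
  rw [arrowWeight_V_V]
  have hperm : ∀ {a₁ a₂ a₃ a₄ a₅ a₆ b₁ b₂ b₃ b₄ b₅ b₆ : ℤ}, a₁ = b₂ → a₂ = b₁ → a₃ = b₄ → a₄ = b₃ →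
      a₅ = b₆ → a₆ = b₅ →
      a₁ + a₂ + a₃ + a₄ + (a₅ + 0 + 0 + a₆) = b₁ + b₂ + b₃ + b₄ + (b₅ + 0 + 0 + b₆) := by
    intros; omega
  rcases lt_trichotomy r 0 with hr | rfl | hr <;> rcases lt_trichotomy s 0 with hs | rfl | hs
  · rw [Lam_of_neg _ _ hr, Lam_of_neg _ _ hs, arrowWeight_V_V]
    refine hperm (if_congr ?_ rfl rfl) (if_congr ?_ rfl rfl) (if_congr ?_ rfl rfl)
      (if_congr ?_ rfl rfl) (if_congr ?_ rfl rfl) (if_congr ?_ rfl rfl) <;> omega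
  · rw [Lam_of_neg _ _ hr, Lam_zero, arrowWeight_V_C]
    simp (disch := omega) only [if_neg]
    split_ifs <;> omega
  · rw [Lam_of_neg _ _ hr, Lam_of_pos _ _ hs, arrowWeight_V_V]
    simp (disch := omega) only [if_neg]
  · rw [Lam_of_neg _ _ hs, Lam_zero, arrowWeight_C_V]
    simp (disch := omega) only [if_neg]
    split_ifs <;> omega
  · rw [Lam_zero, Lam_zero, arrowWeight_C_C]
    simp (disch := omega) only [if_neg]
    rfl
  · rw [Lam_of_pos _ _ hs, Lam_zero, arrowWeight_C_V]
    simp (disch := omega) only [if_neg]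
    split_ifs <;> omega
  · rw [Lam_of_pos _ _ hr, Lam_of_neg _ _ hs, arrowWeight_V_V]
    simp (disch := omega) only [if_neg]
  · rw [Lam_of_pos _ _ hr, Lam_zero, arrowWeight_V_C]
    simp (disch := omega) only [if_neg]
    split_ifs <;> omega
  · rw [Lam_of_pos _ _ hr, Lam_of_pos _ _ hs, arrowWeight_V_V]
    refine hperm (if_congr ?_ rfl rfl) (if_congr ?_ rfl rfl) (if_congr ?_ rfl rfl)
      (if_congr ?_ rfl rfl) (if_congr ?_ rfl rfl) (if_congr ?_ rfl rfl) <;> omega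

theorem eps2_Lam_Lam (n : ℕ) {i r k s : ℤ} (h1 : 1 ≤ i) (h2 : i ≤ n) (h3 : -i ≤ r)
    (h4 : r ≤ i) (h5 : 1 ≤ k) (h6 : k ≤ n) (h7 : -k ≤ s) (h8 : s ≤ k) :
    eps2 n (Lam n i r) (Lam n k s) = eps2 n (.V i r) (.V k s) := by
  rw [eps2_eq_sub, eps2_eq_sub, arrowWeight_Lam_Lam n h1 h2 h3 h4 h5 h6 h7 h8,
    arrowWeight_Lam_Lam n h5 h6 h7 h8 h1 h2 h3 h4]

theorem Lam_valid {n : ℕ} {i r : ℤ} (h : (DnLabel.V i r).valid n) : (Lam n i r).valid n := by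
  obtain ⟨h1, h2, h3, h4⟩ := h
  rcases lt_trichotomy r 0 with hr | rfl | hr
  · rw [Lam_of_neg _ _ hr]; simp only [DnLabel.valid]; omega
  · rw [Lam_zero]; simp only [DnLabel.valid]; omega
  · rw [Lam_of_pos _ _ hr]; simp only [DnLabel.valid]; omega

theorem sum_eps2_same (n : ℕ) {a b : ℤ} (h1 : 1 ≤ a) (h2 : a ≤ n) (h3 : -a ≤ b) {N : ℕ}
    (h4 : b + a + 1 < N) (h5 : (N : ℤ) ≤ 2 * a) :
    ∑ l ∈ Finset.range N, eps2 n (.V a (-a + l)) (.V a b) = if b = -a then -2 else 0 := by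
  have key : ∀ M : ℕ, (M : ℤ) ≤ 2 * a →
      ∑ l ∈ Finset.range M, eps2 n (.V a (-a + l)) (.V a b) =
        (if -a < b ∧ b + a - 1 < M then 2 else 0) - (if b + a + 1 < M then 2 else 0) := by
    intro M hM
    induction M with
    | zero => simp; split_ifs <;> omega
    | succ M ih =>
      rw [Finset.sum_range_succ, ih (by omega),
        eps2_V_V_same n h1 h2 (by omega) (by omega) (by omega) (by omega)]
      push_cast at hM ⊢
      split_ifs <;> omega
  rw [key N h5]
  split_ifs <;> omega

theorem sum_sum_eps2_same (n : ℕ) {a : ℤ} (h1 : 1 ≤ a) (h2 : a ≤ n) {M N : ℕ}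
    (h3 : M + 1 < N) (h5 : (N : ℤ) ≤ 2 * a) :
    ∑ k ∈ Finset.range (M + 1), ∑ l ∈ Finset.range N,
      eps2 n (.V a (-a + l)) (.V a (-a + k)) = -2 := by
  induction M with
  | zero =>
    rw [zero_add, Finset.sum_range_one, sum_eps2_same n h1 h2 (by simp) (by omega) h5]
    simp
  | succ M ih =>
    rw [Finset.sum_range_succ, ih (by omega),
      sum_eps2_same n h1 h2 (by omega) (by omega) h5, if_neg (by omega)]
    rfl

theorem sum_eps2_succ (n : ℕ) {a b : ℤ} (h1 : 1 ≤ a) (h2 : a < n) (h3 : -a ≤ b) (h4 : b < a)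
    (N : ℕ) :
    ∑ l ∈ Finset.range (N + 1), eps2 n (.V a b) (.V (a + 1) (-(a + 1) + l)) =
      if b = -a then (if N = 0 then 1 else -1)
      else if b < 0 then (if N = b + a then 2 else 0)
      else if b = 0 then (if N = a ∨ N = a + 1 then 2 else 0)
      else (if N = b + a + 1 then 2 else 0) := by
  induction N with
  | zero =>
    rw [zero_add, Finset.sum_range_one, eps2_V_V_succ n h1 h2 h3 h4.le]
    split_ifs <;> omega
  | succ N ih =>
    rw [Finset.sum_range_succ, ih, eps2_V_V_succ n h1 h2 h3 h4.le]
    push_cast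
    rcases (by omega : b = -a ∨ (b ≠ -a ∧ b < 0) ∨ b = 0 ∨ 0 < b) with h | h | h | h <;>
      simp (disch := omega) only [if_pos, if_neg] <;> split_ifs <;> omega

theorem sum_sum_eps2_succ (n : ℕ) {a : ℤ} (h1 : 1 ≤ a) (h2 : a < n) {M : ℕ}
    (h3 : (M : ℤ) < 2 * a) (N : ℕ) :
    ∑ k ∈ Finset.range (M + 1), ∑ l ∈ Finset.range (N + 1),
      eps2 n (.V a (-a + k)) (.V (a + 1) (-(a + 1) + l)) =
      if (if (M : ℤ) < a then (M : ℤ) + 1 else M + 2) ≤ N then -1 else 1 := by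
  induction M with
  | zero =>
    rw [zero_add, Finset.sum_range_one, sum_eps2_succ n h1 h2 (by omega) (by omega) N]
    push_cast
    split_ifs <;> omega
  | succ M ih =>
    rw [Finset.sum_range_succ, ih (by omega),
      sum_eps2_succ n h1 h2 (by omega) (by omega) N]
    push_cast
    split_ifs <;> omega

theorem qq_ne_zero : qq ≠ 0 := RatFunc.X_ne_zero

theorem qq_pow_ne_one {m : ℕ} (hm : m ≠ 0) : qq ^ m ≠ 1 := by
  intro h
  have h' : algebraMap (Polynomial ℂ) (RatFunc ℂ) (Polynomial.X ^ m) =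
      algebraMap (Polynomial ℂ) (RatFunc ℂ) 1 := by
    rw [map_pow, RatFunc.algebraMap_X, map_one]; exact h
  have h'' := RatFunc.algebraMap_injective ℂ h'
  have := congrArg Polynomial.natDegree h''
  simp at this
  exact hm this

theorem qq_sq_sub_one_ne_zero : qq ^ 2 - 1 ≠ 0 := sub_ne_zero.2 (qq_pow_ne_one two_ne_zero)

theorem qq_sq_add_one_ne_zero : qq ^ 2 + 1 ≠ 0 := by
  intro h
  apply qq_pow_ne_one (m := 4) (by norm_num)
  linear_combination (qq ^ 2 - 1) * h

theorem qq_sub_inv_ne_zero : qq - qq⁻¹ ≠ 0 := by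
  intro h
  apply qq_sq_sub_one_ne_zero
  have h0 := qq_ne_zero
  field_simp at h
  simpa using h

theorem ii_ne_zero : ii ≠ 0 := by
  unfold ii
  rw [Ne, map_eq_zero]
  exact Complex.I_ne_zero

section QComm

variable {K D : Type*} [Field K] [Ring D] [Algebra K D] {q : K}

/-- `x` and `y` commute up to the factor `q^e`: `x y = q^e y x`. -/
def QComm (q : K) (e : ℤ) (x y : D) : Prop := x * y = q ^ e • (y * x)

theorem QComm.symm (hq : q ≠ 0) {e : ℤ} {x y : D} (h : QComm q e x y) : QComm q (-e) y x := by
  unfold QComm at *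
  rw [h, smul_smul, ← zpow_add₀ hq, neg_add_cancel, zpow_zero, one_smul]

theorem QComm.mul_left (hq : q ≠ 0) {e f : ℤ} {x y z : D} (h : QComm q e x z) (h' : QComm q f y z) :
    QComm q (e + f) (x * y) z := by
  unfold QComm at *
  rw [mul_assoc, h', mul_smul_comm, ← mul_assoc, h, smul_mul_assoc, smul_smul, mul_assoc,
    ← zpow_add₀ hq, add_comm]

theorem QComm.mul_right (hq : q ≠ 0) {e f : ℤ} {x y z : D} (h : QComm q e x y)
    (h' : QComm q f x z) :
    QComm q (e + f) x (y * z) := by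
  have := ((h.symm hq).mul_left hq (h'.symm hq)).symm hq
  rwa [neg_add, neg_neg, neg_neg] at this

theorem QComm.add_right {e : ℤ} {x y z : D} (h : QComm q e x y) (h' : QComm q e x z) :
    QComm q e x (y + z) := by
  unfold QComm at *
  rw [mul_add, add_mul, smul_add, h, h']

theorem QComm.zero_right (q : K) (e : ℤ) (x : D) : QComm q e x 0 := by simp [QComm]

theorem QComm.zero_left (q : K) (e : ℤ) (x : D) : QComm q e 0 x := by simp [QComm]

theorem QComm.sum_right {ι : Type*} {e : ℤ} {x : D} {s : Finset ι} {f : ι → D}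
    (h : ∀ i ∈ s, QComm q e x (f i)) : QComm q e x (∑ i ∈ s, f i) := by
  unfold QComm at *
  rw [Finset.mul_sum, Finset.sum_mul, Finset.smul_sum, Finset.sum_congr rfl h]

theorem QComm.sum_left (hq : q ≠ 0) {ι : Type*} {e : ℤ} {x : D} {s : Finset ι} {f : ι → D}
    (h : ∀ i ∈ s, QComm q e (f i) x) : QComm q e (∑ i ∈ s, f i) x := by
  have := (QComm.sum_right (x := x) (s := s) (f := f) fun i hi => (h i hi).symm hq).symm hq
  rwa [neg_neg] at this

theorem QComm.smul_left {e : ℤ} {x y : D} (c : K) (h : QComm q e x y) : QComm q e (c • x) y := by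
  unfold QComm at *
  rw [smul_mul_assoc, h, mul_smul_comm, smul_comm]

theorem QComm.smul_right {e : ℤ} {x y : D} (c : K) (h : QComm q e x y) : QComm q e x (c • y) := by
  unfold QComm at *
  rw [smul_mul_assoc, mul_smul_comm, h, smul_comm]

theorem QComm.prod_right (hq : q ≠ 0) {x : D} {f : ℕ → D} {e : ℕ → ℤ} (N : ℕ)
    (h : ∀ k < N, QComm q (e k) x (f k)) :
    QComm q (∑ k ∈ Finset.range N, e k) x ((List.range N).map f).prod := by
  induction N with
  | zero => simp [QComm]
  | succ N ih =>
    rw [Finset.sum_range_succ, List.range_succ, List.map_append, List.prod_append]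
    simpa using (ih fun k hk => h k (hk.trans N.lt_succ_self)).mul_right hq (h N N.lt_succ_self)

theorem QComm.prod_prod (hq : q ≠ 0) {f g : ℕ → D} {e : ℕ → ℕ → ℤ} (M N : ℕ)
    (h : ∀ k < M, ∀ l < N, QComm q (e k l) (f k) (g l)) :
    QComm q (∑ k ∈ Finset.range M, ∑ l ∈ Finset.range N, e k l)
      ((List.range M).map f).prod ((List.range N).map g).prod := by
  have := QComm.prod_right hq M fun k hk => (QComm.prod_right hq N fun l hl => h k hk l hl).symm hq
  simpa using this.symm hq

end QComm

theorem Xg_mul_Xg {n : ℕ} {u v : DnLabel} (hu : u.valid n) (hv : v.valid n) :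
    QComm qq (eps2 n v u) (Xg n u) (Xg n v) := by
  have := RingQuot.mkAlgHom_rel Kq (DnRel.comm (n := n) ⟨u, hu⟩ ⟨v, hv⟩)
  rw [map_mul, map_smul, map_mul] at this
  simpa only [QComm, Xg, hu, hv, dif_pos] using this

theorem isUnit_Xg (n : ℕ) (v : DnLabel) : IsUnit (Xg n v) := by
  unfold Xg
  split_ifs with h
  · refine ⟨⟨_, RingQuot.mkAlgHom Kq (DnRel n) (FreeAlgebra.ι Kq (Sum.inr ⟨v, h⟩)), ?_, ?_⟩, rfl⟩
    · have := RingQuot.mkAlgHom_rel Kq (DnRel.mul_inv (n := n) ⟨v, h⟩)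
      rwa [map_mul, map_one] at this
    · have := RingQuot.mkAlgHom_rel Kq (DnRel.inv_mul (n := n) ⟨v, h⟩)
      rwa [map_mul, map_one] at this
  · exact isUnit_one

/-- A labelling of vertices by `(i, r)` having the same exchange matrix as the labels `V_{i,r}`. -/
structure IsPathLabelling (n : ℕ) (lab : ℤ → ℤ → DnLabel) : Prop where
  valid : ∀ {i r : ℤ}, (DnLabel.V i r).valid n → (lab i r).valid n
  eps2_eq : ∀ {i r k s : ℤ}, (DnLabel.V i r).valid n → (DnLabel.V k s).valid n →
    eps2 n (lab i r) (lab k s) = eps2 n (.V i r) (.V k s)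

theorem isPathLabelling_V (n : ℕ) : IsPathLabelling n DnLabel.V :=
  ⟨fun h => h, fun _ _ => rfl⟩

theorem isPathLabelling_Lam (n : ℕ) : IsPathLabelling n (Lam n) :=
  ⟨Lam_valid, fun h h' => eps2_Lam_Lam n h.1 h.2.1 h.2.2.1 h.2.2.2 h'.1 h'.2.1 h'.2.2.1 h'.2.2.2⟩

/-- The monomial `𝐢 q^{i+r} X_{i,-i} ⋯ X_{i,r}` along the `i`-th path of a labelling. -/
def pathMonomial (n : ℕ) (lab : ℤ → ℤ → DnLabel) (i r : ℤ) : Dtorus n :=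
  (ii * qq ^ (i + r)) •
    ((List.range (r + i + 1).toNat).map fun k : ℕ => Xg n (lab i (-i + k))).prod

theorem map_cast_eq {α : Type*} (l : List ℕ) (f : ℤ → α) :
    (List.map f do let a ← l; pure (a : ℤ)) = l.map fun k : ℕ => f k := by
  have h : (do let a ← l; pure (a : ℤ)) = l.map fun a : ℕ => (a : ℤ) :=
    List.flatMap_pure_eq_map _ l
  rw [h, List.map_map]
  rfl

theorem ww_eq_pathMonomial (n : ℕ) (i r : ℤ) : ww n i r = pathMonomial n DnLabel.V i r := by
  unfold ww Vprod pathMonomial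
  rw [map_cast_eq]

theorem mm_eq_pathMonomial (n : ℕ) (i r : ℤ) : mm n i r = pathMonomial n (Lam n) i r := by
  unfold mm Lprod pathMonomial
  rw [map_cast_eq]

theorem isUnit_pathMonomial (n : ℕ) (lab : ℤ → ℤ → DnLabel) (i r : ℤ) :
    IsUnit (pathMonomial n lab i r) := by
  unfold pathMonomial
  have hc : ii * qq ^ (i + r) ≠ 0 := mul_ne_zero ii_ne_zero (zpow_ne_zero _ qq_ne_zero)
  have hu : ∀ N : ℕ, IsUnit ((List.range N).map fun k : ℕ => Xg n (lab i (-i + k))).prod := by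
    intro N
    induction N with
    | zero => simp
    | succ N ih =>
      rw [List.range_succ, List.map_append, List.prod_append]
      simpa using ih.mul (isUnit_Xg n _)
  have := ((Units.mk0 _ hc).isUnit.map (algebraMap Kq (Dtorus n))).mul (hu (r + i + 1).toNat)
  rwa [Units.val_mk0, ← Algebra.smul_def] at this

/-- The threshold from which the monomials of the next path have positive
commutation exponent with the monomial of index `s`. -/
def pathThreshold (s : ℤ) : ℤ := if s < 0 then s else s + 1

section

variable {n : ℕ} {lab : ℤ → ℤ → DnLabel}

theorem IsPathLabelling.qcomm (hl : IsPathLabelling n lab) {a r c s : ℤ} (ha : 1 ≤ a)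
    (ha' : a ≤ n) (hr' : r < a)
    (hc : 1 ≤ c) (hc' : c ≤ n) (hs' : s < c) :
    QComm qq (∑ k ∈ Finset.range (r + a + 1).toNat, ∑ l ∈ Finset.range (s + c + 1).toNat,
      eps2 n (.V c (-c + l)) (.V a (-a + k))) (pathMonomial n lab a r) (pathMonomial n lab c s) := by
  refine ((QComm.prod_prod qq_ne_zero _ _ ?_).smul_left _).smul_right _
  intro k hk l hl'
  have h1 : (DnLabel.V a (-a + k)).valid n := by simp only [DnLabel.valid]; omega
  have h2 : (DnLabel.V c (-c + l)).valid n := by simp only [DnLabel.valid]; omega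
  rw [← hl.eps2_eq h2 h1]
  exact Xg_mul_Xg (hl.valid h1) (hl.valid h2)

theorem IsPathLabelling.qcomm_same (hl : IsPathLabelling n lab) {a r s : ℤ} (ha : 1 ≤ a)
    (ha' : a ≤ n) (hr : -a ≤ r)
    (hrs : r < s) (hs : s < a) :
    QComm qq (-2) (pathMonomial n lab a r) (pathMonomial n lab a s) := by
  have h := hl.qcomm ha ha' (hrs.trans hs) ha ha' hs
  rw [show (r + a + 1).toNat = (r + a).toNat + 1 by omega,
    sum_sum_eps2_same n ha ha' (by omega) (by omega)] at h
  exact h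

theorem IsPathLabelling.qcomm_succ (hl : IsPathLabelling n lab) {a r s : ℤ} (ha : 1 ≤ a)
    (ha' : a < n) (hs : -a ≤ s)
    (hs' : s < a) (hr : -(a + 1) ≤ r) (hr' : r < a + 1) :
    QComm qq (if pathThreshold s ≤ r then 1 else -1)
      (pathMonomial n lab a s) (pathMonomial n lab (a + 1) r) := by
  have h := hl.qcomm ha ha'.le hs' (by omega : 1 ≤ a + 1) (by omega) hr'
  simp only [eps2_swap n (.V a _), Finset.sum_neg_distrib] at h
  rw [show (s + a + 1).toNat = (s + a).toNat + 1 by omega,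
    show (r + (a + 1) + 1).toNat = (r + (a + 1)).toNat + 1 by omega,
    sum_sum_eps2_succ n ha ha' (by omega)] at h
  convert h using 1
  unfold pathThreshold
  split_ifs <;> omega

theorem IsPathLabelling.qcomm_far (hl : IsPathLabelling n lab) {a r c s : ℤ} (ha : 1 ≤ a)
    (hr' : r < a) (hac : a + 2 ≤ c)
    (hc' : c ≤ n) (hs' : s < c) :
    QComm qq 0 (pathMonomial n lab a r) (pathMonomial n lab c s) := by
  have h := hl.qcomm ha (by omega) hr' (by omega) hc' hs'
  simpa [eps2_swap n (.V a _), eps2_V_V_far n hac] using h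

end

section Serre

variable {K D : Type*} [Field K] [Ring D] [Algebra K D] {q : K}

/-- The quantum Serre relation `x²y − (q+q⁻¹)xyx + yx² = 0`. -/
def QSerre (q : K) (x y : D) : Prop := x * (x * y) + y * (x * x) = (q + q⁻¹) • (x * (y * x))

theorem qSerre_of_split (hq : q ≠ 0) {x₁ x₂ y : D} (h₁ : QComm q 1 y x₁) (h₂ : QComm q (-1) y x₂)
    (h : QComm q 2 x₁ x₂) : QSerre q (x₁ + x₂) y := by
  simp only [QComm, zpow_one, zpow_neg] at h₁ h₂ h
  have r₁ : ∀ z, y * (x₁ * z) = q • (x₁ * (y * z)) := fun z => by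
    rw [← mul_assoc, h₁, smul_mul_assoc, mul_assoc]
  have r₂ : ∀ z, y * (x₂ * z) = q⁻¹ • (x₂ * (y * z)) := fun z => by
    rw [← mul_assoc, h₂, smul_mul_assoc, mul_assoc]
  have r : ∀ z, x₁ * (x₂ * z) = q ^ (2 : ℤ) • (x₂ * (x₁ * z)) := fun z => by
    rw [← mul_assoc, h, smul_mul_assoc, mul_assoc]
  simp only [QSerre, mul_add, add_mul, h₁, h₂, r₁, r₂, r, mul_smul_comm, smul_add]
  match_scalars <;> field_simp <;> ring

theorem QSerre.qcomm_left (hq : q ≠ 0) {a b : D} (h : QSerre q a b) (c : K) :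
    QComm q (-1) a (c • (a * b - q • (b * a))) := by
  refine QComm.smul_right _ ?_
  simp only [QSerre, QComm, zpow_neg, zpow_one, mul_sub, sub_mul, mul_smul_comm, smul_mul_assoc,
    mul_assoc] at h ⊢
  linear_combination (norm := skip) h
  match_scalars <;> field_simp <;> ring

theorem QSerre.qcomm_right (hq : q ≠ 0) {a b : D} (h : QSerre q b a) (c : K) :
    QComm q (-1) (c • (a * b - q • (b * a))) b := by
  refine QComm.smul_left _ ?_
  simp only [QSerre, QComm, zpow_neg, zpow_one, mul_sub, sub_mul, mul_smul_comm, smul_mul_assoc,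
    mul_assoc] at h ⊢
  linear_combination (norm := skip) h
  match_scalars <;> field_simp <;> ring

theorem QSerre.bracket_right (hq : q ≠ 0) {a b x : D} (h : QSerre q b x) (hab : Commute a b)
    (c : K) :
    QSerre q b (c • (a * x - q • (x * a))) := by
  have r : ∀ z, b * (a * z) = a * (b * z) := fun z => by
    rw [← mul_assoc, ← hab.eq, mul_assoc]
  have h₁ := congrArg (fun z => a * z) h
  have h₂ := congrArg (fun z => z * a) h
  simp only [QSerre, mul_sub, sub_mul, mul_add, add_mul, mul_smul_comm, smul_mul_assoc,
    mul_assoc, hab.symm.eq, r] at h₁ h₂ ⊢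
  linear_combination (norm := skip) c • h₁ - (c * q) • h₂
  match_scalars <;> field_simp <;> ring

theorem QSerre.bracket_left (hq : q ≠ 0) (hμ : q - q⁻¹ ≠ 0) (hν : q + q⁻¹ ≠ 0)
    {a b x y : D} (h : QSerre q x b) (hab : Commute a b)
    (hy : y = (q - q⁻¹)⁻¹ • (a * x - q • (x * a))) (hay : QComm q (-1) a y)
    (hyx : QComm q (-1) y x) : QSerre q y b := by
  have hax : a * x = q • (x * a) + (q - q⁻¹) • y := by
    rw [hy, smul_smul, mul_inv_cancel₀ hμ, one_smul]; abel
  clear hy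
  have hba : a * b = b * a := hab.eq
  simp only [QComm, zpow_one, zpow_neg] at hay hyx
  have r₁ : ∀ z, a * (x * z) = q • (x * (a * z)) + (q - q⁻¹) • (y * z) := fun z => by
    rw [← mul_assoc, hax, add_mul, smul_mul_assoc, smul_mul_assoc, mul_assoc]
  have r₂ : ∀ z, a * (b * z) = b * (a * z) := fun z => by rw [← mul_assoc, hba, mul_assoc]
  have r₃ : ∀ z, a * (y * z) = q⁻¹ • (y * (a * z)) := fun z => by
    rw [← mul_assoc, hay, smul_mul_assoc, mul_assoc]
  have r₄ : ∀ z, y * (x * z) = q⁻¹ • (x * (y * z)) := fun z => by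
    rw [← mul_assoc, hyx, smul_mul_assoc, mul_assoc]
  have hT : x * (y * b) + b * (x * y) = q • (x * (b * y)) + y * (b * x) := by
    have h₁ := congrArg (fun z => a * z) h
    have h₂ := congrArg (fun z => z * a) h
    simp only [mul_add, add_mul, mul_smul_comm, smul_mul_assoc, mul_assoc, smul_add,
      hax, hba, hyx, r₁, r₂, r₄] at h₁ h₂
    have hc : (q + q⁻¹) * (q - q⁻¹) ≠ 0 := mul_ne_zero hν hμ
    rw [← sub_eq_zero]
    refine (smul_eq_zero.1 ?_).resolve_left hc
    linear_combination (norm := skip) h₁ - q ^ 2 • h₂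
    match_scalars <;> field_simp <;> ring
  have h₁ := congrArg (fun z => a * z) hT
  have h₂ := congrArg (fun z => z * a) hT
  simp only [mul_add, add_mul, mul_smul_comm, smul_mul_assoc, mul_assoc, smul_add,
    hax, hba, hay, r₁, r₂, r₃] at h₁ h₂
  unfold QSerre
  rw [← sub_eq_zero]
  refine (smul_eq_zero.1 ?_).resolve_left hμ
  linear_combination (norm := skip) h₁ - h₂
  match_scalars <;> field_simp <;> ring

/-- The iterated `q`-brackets `[⋯[[b 0, b 1], b 2], ⋯, b k]`. -/
def iterBracket (q : K) (b : ℕ → D) : ℕ → D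
  | 0 => b 0
  | k + 1 => (q - q⁻¹)⁻¹ • (iterBracket q b k * b (k + 1) - q • (b (k + 1) * iterBracket q b k))

theorem iterBracket_relations (hq : q ≠ 0) (hμ : q - q⁻¹ ≠ 0) (hν : q + q⁻¹ ≠ 0)
    {b : ℕ → D} {N : ℕ}
    (hS : ∀ l < N, QSerre q (b l) (b (l + 1))) (hS' : ∀ l < N, QSerre q (b (l + 1)) (b l))
    (hc : ∀ l m, l + 2 ≤ m → m ≤ N → Commute (b l) (b m)) (k : ℕ) :
    (∀ m, k + 2 ≤ m → m ≤ N → Commute (iterBracket q b k) (b m)) ∧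
      (k < N → QSerre q (iterBracket q b k) (b (k + 1)) ∧ QSerre q (b (k + 1)) (iterBracket q b k)) := by
  induction k with
  | zero => exact ⟨fun m => hc 0 m, fun h => ⟨hS 0 h, hS' 0 h⟩⟩
  | succ k ih =>
    obtain ⟨ih₁, ih₂⟩ := ih
    constructor
    · intro m hm hm'
      have h₁ := ih₁ m (by omega) hm'
      have h₂ := hc (k + 1) m hm hm'
      exact ((h₁.mul_left h₂).sub_left ((h₂.mul_left h₁).smul_left _)).smul_left _
    · intro hk
      obtain ⟨h₁, h₂⟩ := ih₂ (by omega)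
      have h₃ := ih₁ (k + 2) le_rfl hk
      exact ⟨(hS (k + 1) hk).bracket_left hq hμ hν h₃ rfl (h₁.qcomm_left hq _) (h₂.qcomm_right hq _),
        (hS' (k + 1) hk).bracket_right hq h₃ _⟩

end Serre

section SerreSum

variable {K D ι : Type*} [Field K] [Ring D] [Algebra K D] {q : K}

theorem QSerre.sum_right {X : D} {I : Finset ι} {f : ι → D} (h : ∀ i ∈ I, QSerre q X (f i)) :
    QSerre q X (∑ i ∈ I, f i) := by
  unfold QSerre at *
  simp only [Finset.mul_sum, Finset.sum_mul, Finset.smul_sum]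
  rw [← Finset.sum_add_distrib]
  exact Finset.sum_congr rfl h

theorem qSerre_sum_of_pred (hq : q ≠ 0) {I : Finset ι} {f : ι → D} {y : D} (p : ι → Prop)
    (h₁ : ∀ i ∈ I, p i → QComm q 1 y (f i)) (h₂ : ∀ i ∈ I, ¬ p i → QComm q (-1) y (f i))
    (h : ∀ i ∈ I, ∀ k ∈ I, p i → ¬ p k → QComm q 2 (f i) (f k)) :
    QSerre q (∑ i ∈ I, f i) y := by
  classical
  rw [← Finset.sum_filter_add_sum_filter_not I p]
  refine qSerre_of_split hq
    (QComm.sum_right fun i hi => h₁ i (Finset.mem_filter.1 hi).1 (Finset.mem_filter.1 hi).2)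
    (QComm.sum_right fun i hi => h₂ i (Finset.mem_filter.1 hi).1 (Finset.mem_filter.1 hi).2)
    (QComm.sum_right fun k hk => QComm.sum_left hq fun i hi => ?_)
  rw [Finset.mem_filter] at hk hi
  exact h i hi.1 k hk.1 hi.2 hk.2

end SerreSum

theorem pathThreshold_lt {s r : ℤ} (h : pathThreshold s < pathThreshold r) : s < r := by
  unfold pathThreshold at h
  split_ifs at h <;> omega

theorem Ev_eq_sum (n : ℕ) (a : ℤ) :
    Ev n a = ∑ r ∈ Finset.Icc (-a) (a - 1), pathMonomial n DnLabel.V a r :=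
  Finset.sum_congr rfl fun r _ => ww_eq_pathMonomial n a r

theorem qSerre_Ev_succ {n : ℕ} {a : ℤ} (ha : 1 ≤ a) (ha' : a < n) :
    QSerre qq (Ev n a) (Ev n (a + 1)) := by
  have hl := isPathLabelling_V n
  rw [Ev_eq_sum, Ev_eq_sum]
  refine QSerre.sum_right fun r hr => ?_
  rw [Finset.mem_Icc] at hr
  refine qSerre_sum_of_pred qq_ne_zero (fun s => ¬ pathThreshold s ≤ r) ?_ ?_ ?_
  · intro s hs hp
    rw [Finset.mem_Icc] at hs
    have h := hl.qcomm_succ ha ha' hs.1 (by omega : s < a) hr.1 (by omega : r < a + 1)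
    rw [if_neg hp] at h
    exact h.symm qq_ne_zero
  · intro s hs hp
    rw [Finset.mem_Icc] at hs
    have h := hl.qcomm_succ ha ha' hs.1 (by omega : s < a) hr.1 (by omega : r < a + 1)
    rw [if_pos (not_not.1 hp)] at h
    exact h.symm qq_ne_zero
  · intro s hs t ht hp hp'
    rw [Finset.mem_Icc] at hs ht
    have hts := pathThreshold_lt (lt_of_le_of_lt (not_not.1 hp') (not_le.1 hp))
    exact (hl.qcomm_same ha ha'.le ht.1 hts (by omega)).symm qq_ne_zero

theorem qSerre_succ_Ev {n : ℕ} {a : ℤ} (ha : 1 ≤ a) (ha' : a < n) :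
    QSerre qq (Ev n (a + 1)) (Ev n a) := by
  have hl := isPathLabelling_V n
  rw [Ev_eq_sum, Ev_eq_sum]
  refine QSerre.sum_right fun s hs => ?_
  rw [Finset.mem_Icc] at hs
  refine qSerre_sum_of_pred qq_ne_zero (fun r => pathThreshold s ≤ r) ?_ ?_ ?_
  · intro r hr hp
    rw [Finset.mem_Icc] at hr
    have h := hl.qcomm_succ ha ha' hs.1 (by omega : s < a) hr.1 (by omega : r < a + 1)
    rwa [if_pos hp] at h
  · intro r hr hp
    rw [Finset.mem_Icc] at hr
    have h := hl.qcomm_succ ha ha' hs.1 (by omega : s < a) hr.1 (by omega : r < a + 1)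
    rwa [if_neg hp] at h
  · intro r hr t ht hp hp'
    rw [Finset.mem_Icc] at hr ht
    have htr : t < r := (not_le.1 hp').trans_le hp
    exact (hl.qcomm_same (by omega) (by omega) ht.1 htr (by omega)).symm qq_ne_zero

theorem commute_Ev {n : ℕ} {a c : ℤ} (ha : 1 ≤ a) (hac : a + 2 ≤ c) (hc : c ≤ n) :
    Commute (Ev n a) (Ev n c) := by
  have h : QComm qq 0 (Ev n a) (Ev n c) := by
    rw [Ev_eq_sum, Ev_eq_sum]
    refine QComm.sum_right fun s hs => QComm.sum_left qq_ne_zero fun r hr => ?_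
    rw [Finset.mem_Icc] at hs hr
    exact (isPathLabelling_V n).qcomm_far ha (by omega) hac hc (by omega)
  rwa [QComm, zpow_zero, one_smul] at h

theorem EEaux_eq_iterBracket (n : ℕ) (i : ℤ) (k : ℕ) :
    EEaux n i k = iterBracket qq (fun l : ℕ => Ev n (i + l)) k := by
  induction k with
  | zero => simp [EEaux, iterBracket]
  | succ k ih =>
    rw [EEaux, iterBracket, ih, show i + ((k + 1 : ℕ) : ℤ) = i + k + 1 by push_cast; ring]

theorem qq_add_inv_ne_zero : qq + qq⁻¹ ≠ 0 := by
  intro h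
  apply qq_sq_add_one_ne_zero
  have h0 := qq_ne_zero
  field_simp at h
  simpa using h

theorem EE_succ (n : ℕ) {i j : ℤ} (hij : i ≤ j) :
    EE n i (j + 1) = (qq - qq⁻¹)⁻¹ • (EE n i j * Ev n (j + 1) - qq • (Ev n (j + 1) * EE n i j)) := by
  unfold EE
  rw [show (j + 1 - i).toNat = (j - i).toNat + 1 by omega, EEaux,
    show i + ((j - i).toNat : ℤ) + 1 = j + 1 by omega]

theorem EE_relations {n : ℕ} {i j : ℤ} (hi : 1 ≤ i) (hij : i ≤ j) (hj : j < n) :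
    QComm qq (-1) (EE n i j) (EE n i (j + 1)) ∧ QComm qq (-1) (EE n i (j + 1)) (Ev n (j + 1)) := by
  have h := ((iterBracket_relations (b := fun l : ℕ => Ev n (i + l)) (N := (n - i).toNat)
    qq_ne_zero qq_sub_inv_ne_zero qq_add_inv_ne_zero ?_ ?_ ?_ (j - i).toNat).2 (by omega))
  · rw [← EEaux_eq_iterBracket] at h
    simp only [show i + (((j - i).toNat + 1 : ℕ) : ℤ) = j + 1 by omega] at h
    rw [EE_succ n hij]
    exact ⟨h.1.qcomm_left qq_ne_zero _, h.2.qcomm_right qq_ne_zero _⟩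
  · intro l hl
    simp only [Nat.cast_add, Nat.cast_one, ← add_assoc]
    exact qSerre_Ev_succ (by omega) (by omega)
  · intro l hl
    simp only [Nat.cast_add, Nat.cast_one, ← add_assoc]
    exact qSerre_succ_Ev (by omega) (by omega)
  · intro l m hlm hm
    exact commute_Ev (by omega) (by omega) (by omega)

section LowerFusion

variable {K D : Type*} [Field K] [Ring D] [Algebra K D]

/-- The terms `G k r` of the iterated bracket of the sums `∑ r ∈ I k, x k r`: each `x (k + 1) r`
is multiplied by the terms of level `k` whose index is at least the threshold `T r`. -/
def fusedTerm (I : ℕ → Finset ℤ) (T : ℤ → ℤ) (x : ℕ → ℤ → D) : ℕ → ℤ → D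
  | 0, r => x 0 r
  | k + 1, r => (∑ t ∈ I k with T r ≤ t, fusedTerm I T x k t) * x (k + 1) r

/-- The part of the sum of level `k` whose indices are at least the threshold `T s`. -/
def fusedUpper (I : ℕ → Finset ℤ) (T : ℤ → ℤ) (x : ℕ → ℤ → D) (k : ℕ) (s : ℤ) : D :=
  ∑ t ∈ I k with T s ≤ t, fusedTerm I T x k t

/-- The part of the sum of level `k` whose indices are below the threshold `T s`. -/
def fusedLower (I : ℕ → Finset ℤ) (T : ℤ → ℤ) (x : ℕ → ℤ → D) (k : ℕ) (s : ℤ) : D :=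
  ∑ t ∈ I k with ¬ T s ≤ t, fusedTerm I T x k t

/-- The commutation relations of the monomials along consecutive paths. -/
structure IsPathFamily (q : K) (T : ℤ → ℤ) (x : ℕ → ℤ → D) : Prop where
  mono : Monotone T
  same : ∀ k {s r : ℤ}, s < r → QComm q (-2) (x k s) (x k r)
  succ : ∀ k s r, QComm q (if T s ≤ r then 1 else -1) (x (k + 1) s) (x k r)
  far : ∀ {k l : ℕ} s r, k + 2 ≤ l → QComm q 0 (x l s) (x k r)

variable {q : K} {I : ℕ → Finset ℤ} {T : ℤ → ℤ} {x : ℕ → ℤ → D}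

theorem fusedTerm_succ (k : ℕ) (r : ℤ) :
    fusedTerm I T x (k + 1) r = fusedUpper I T x k r * x (k + 1) r := rfl

theorem fusedLower_add_fusedUpper (k : ℕ) (s : ℤ) :
    fusedLower I T x k s + fusedUpper I T x k s = ∑ t ∈ I k, fusedTerm I T x k t := by
  rw [add_comm]
  exact Finset.sum_filter_add_sum_filter_not _ _ _

theorem IsPathFamily.qcomm_fusedTerm_far (hx : IsPathFamily q T x) (hq : q ≠ 0) (k : ℕ) :
    ∀ {l : ℕ} (s r : ℤ), k + 2 ≤ l → QComm q 0 (x l s) (fusedTerm I T x k r) := by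
  induction k with
  | zero => exact fun s r hl => hx.far s r hl
  | succ k ih =>
    intro l s r hl
    exact (QComm.sum_right fun t _ => ih s t (by omega)).mul_right hq (hx.far s r hl)

theorem IsPathFamily.qcomm_fusedTerm (hx : IsPathFamily q T x) (hq : q ≠ 0) (k : ℕ) (s r : ℤ) :
    QComm q (if T s ≤ r then 1 else -1) (x (k + 1) s) (fusedTerm I T x k r) := by
  cases k with
  | zero => exact hx.succ 0 s r
  | succ k =>
    have h : QComm q 0 (x (k + 2) s) (fusedUpper I T x k r) :=
      QComm.sum_right fun t _ => hx.qcomm_fusedTerm_far hq k s t le_rfl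
    have := h.mul_right hq (hx.succ (k + 1) s r)
    rwa [zero_add] at this

theorem IsPathFamily.qcomm_fusedUpper (hx : IsPathFamily q T x) (hq : q ≠ 0) (k : ℕ) {s r : ℤ}
    (h : s ≤ r) :
    QComm q 1 (x (k + 1) s) (fusedUpper I T x k r) := by
  refine QComm.sum_right fun t ht => ?_
  have := hx.qcomm_fusedTerm (I := I) hq k s t
  rwa [if_pos ((hx.mono h).trans (Finset.mem_filter.1 ht).2)] at this

theorem IsPathFamily.qcomm_fusedLower (hx : IsPathFamily q T x) (hq : q ≠ 0) (k : ℕ) (s : ℤ) :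
    QComm q (-1) (x (k + 1) s) (fusedLower I T x k s) := by
  refine QComm.sum_right fun t ht => ?_
  have := hx.qcomm_fusedTerm (I := I) hq k s t
  rwa [if_neg (Finset.mem_filter.1 ht).2] at this

theorem IsPathFamily.qcomm_fusedTerm_succ (hx : IsPathFamily q T x) (hq : q ≠ 0) (k : ℕ) {s r : ℤ}
    (h : s < r) :
    QComm q (-1) (x (k + 1) s) (fusedTerm I T x (k + 1) r) :=
  (hx.qcomm_fusedUpper hq k h.le).mul_right hq (hx.same (k + 1) h)

theorem IsPathFamily.qcomm_fusedUpper_fusedTerm_succ (hx : IsPathFamily q T x) (hq : q ≠ 0)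
    (k : ℕ) {s r : ℤ} (h : s < r)
    (ih : ∀ {s r : ℤ}, s < r → QComm q (-2) (fusedTerm I T x k s) (fusedTerm I T x k r)) :
    QComm q (-1) (fusedUpper I T x k s) (fusedTerm I T x (k + 1) r) := by
  have hsplit : fusedUpper I T x k s = fusedUpper I T x k r +
      ∑ t ∈ I k with T s ≤ t ∧ ¬ T r ≤ t, fusedTerm I T x k t := by
    unfold fusedUpper
    rw [← Finset.sum_filter_add_sum_filter_not ({t ∈ I k | T s ≤ t}) (fun t => T r ≤ t),
      Finset.filter_filter, Finset.filter_filter]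
    congr 1
    refine Finset.sum_congr (Finset.filter_congr fun t _ => ?_) fun _ _ => rfl
    exact ⟨fun h => h.2, fun h' => ⟨(hx.mono h.le).trans h', h'⟩⟩
  have h₁ : QComm q (-1) (fusedUpper I T x k r) (fusedTerm I T x (k + 1) r) := by
    have h₀ : QComm q 0 (fusedUpper I T x k r) (fusedUpper I T x k r) := by simp [QComm]
    exact h₀.mul_right hq ((hx.qcomm_fusedUpper hq k le_rfl).symm hq)
  have h₂ : QComm q (-1) (∑ t ∈ I k with T s ≤ t ∧ ¬ T r ≤ t, fusedTerm I T x k t)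
      (fusedTerm I T x (k + 1) r) := by
    refine QComm.sum_left hq fun t ht => ?_
    have htr := (Finset.mem_filter.1 ht).2.2
    have h₃ := hx.qcomm_fusedTerm (I := I) hq k r t
    rw [if_neg htr] at h₃
    exact QComm.mul_right hq
      (QComm.sum_right fun u hu => ih ((not_le.1 htr).trans_le (Finset.mem_filter.1 hu).2))
      (h₃.symm hq)
  rw [hsplit]
  have := (h₁.symm hq).add_right (h₂.symm hq)
  exact this.symm hq

theorem IsPathFamily.qcomm_fusedTerm_same (hx : IsPathFamily q T x) (hq : q ≠ 0) (k : ℕ) :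
    ∀ {s r : ℤ}, s < r → QComm q (-2) (fusedTerm I T x k s) (fusedTerm I T x k r) := by
  induction k with
  | zero => exact fun h => hx.same 0 h
  | succ k ih =>
    intro s r h
    exact (hx.qcomm_fusedUpper_fusedTerm_succ hq k h ih).mul_left hq
      (hx.qcomm_fusedTerm_succ hq k h)

theorem IsPathFamily.sum_fusedTerm_succ (hx : IsPathFamily q T x) (hq : q ≠ 0) (hμ : q - q⁻¹ ≠ 0)
    (k : ℕ) :
    (q - q⁻¹)⁻¹ • ((∑ r ∈ I (k + 1), x (k + 1) r) * (∑ r ∈ I k, fusedTerm I T x k r) -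
        q⁻¹ • ((∑ r ∈ I k, fusedTerm I T x k r) * ∑ r ∈ I (k + 1), x (k + 1) r)) =
      ∑ r ∈ I (k + 1), fusedTerm I T x (k + 1) r := by
  rw [inv_smul_eq_iff₀ hμ, Finset.sum_mul, Finset.mul_sum, Finset.smul_sum, Finset.smul_sum,
    ← Finset.sum_sub_distrib]
  refine Finset.sum_congr rfl fun s _ => ?_
  have h₁ := hx.qcomm_fusedUpper (I := I) hq k (le_refl s)
  have h₂ := hx.qcomm_fusedLower (I := I) hq k s
  simp only [QComm, zpow_one, zpow_neg] at h₁ h₂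
  rw [← fusedLower_add_fusedUpper k s, fusedTerm_succ, mul_add, add_mul, h₁, h₂, smul_add, sub_smul]
  abel

end LowerFusion

theorem eq_of_qcomm_decomposition {K D : Type*} [Field K] [Ring D] [Algebra K D] {q : K}
    (hμ : q - q⁻¹ ≠ 0) {y : D} (hy : IsUnit y) {a b c d : D} (h : a + b = c + d)
    (ha : y * a = q⁻¹ • (a * y)) (hb : y * b = q • (b * y)) (hc : y * c = q⁻¹ • (c * y))
    (hd : y * d = q • (d * y)) : b = d := by
  have h₀ : a - c = d - b := by rw [sub_eq_sub_iff_add_eq_add, h, add_comm]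
  have h₁ : y * (d - b) = q • ((d - b) * y) := by rw [mul_sub, sub_mul, smul_sub, hb, hd]
  have h₂ : y * (d - b) = q⁻¹ • ((d - b) * y) := by
    rw [← h₀, mul_sub, sub_mul, smul_sub, ha, hc]
  have h₃ : (q - q⁻¹) • ((d - b) * y) = 0 := by rw [sub_smul, ← h₁, ← h₂, sub_self]
  have h₄ := (smul_eq_zero.1 h₃).resolve_left hμ
  exact (sub_eq_zero.1 ((hy.mul_left_eq_zero).1 h₄)).symm

/-- The monomials `m_{θ(i+k)}^r`, extended by zero outside their range of indices. -/
def lowerFamily (n : ℕ) (i : ℤ) (k : ℕ) (r : ℤ) : Dtorus n :=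
  if 1 ≤ th n (i + k) ∧ -th n (i + k) ≤ r ∧ r < th n (i + k) then mm n (th n (i + k)) r else 0

theorem pathThreshold_mono : Monotone pathThreshold := by
  intro s r h
  unfold pathThreshold
  split_ifs <;> omega

theorem isPathFamily_lowerFamily (n : ℕ) {i : ℤ} (hi : 1 ≤ i) :
    IsPathFamily qq pathThreshold (lowerFamily n i) := by
  have hl := isPathLabelling_Lam n
  refine ⟨pathThreshold_mono, ?_, ?_, ?_⟩
  · intro k s r h
    unfold lowerFamily
    split_ifs with h₁ h₂
    · rw [mm_eq_pathMonomial, mm_eq_pathMonomial]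
      exact hl.qcomm_same h₁.1 (by unfold th; omega) h₁.2.1 h h₂.2.2
    all_goals first | exact QComm.zero_left _ _ _ | exact QComm.zero_right _ _ _
  · intro k s r
    unfold lowerFamily
    by_cases h₁ : 1 ≤ th n (i + ((k + 1 : ℕ) : ℤ)) ∧ -th n (i + ((k + 1 : ℕ) : ℤ)) ≤ s ∧
      s < th n (i + ((k + 1 : ℕ) : ℤ))
    · by_cases h₂ : 1 ≤ th n (i + k) ∧ -th n (i + k) ≤ r ∧ r < th n (i + k)
      · rw [if_pos h₁, if_pos h₂, mm_eq_pathMonomial, mm_eq_pathMonomial]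
        have e : th n (i + k) = th n (i + ((k + 1 : ℕ) : ℤ)) + 1 := by unfold th; push_cast; ring
        rw [e] at h₂ ⊢
        exact hl.qcomm_succ h₁.1 (by unfold th; omega) h₁.2.1 h₁.2.2 h₂.2.1 h₂.2.2
      · rw [if_neg h₂]
        exact QComm.zero_right _ _ _
    · rw [if_neg h₁]
      exact QComm.zero_left _ _ _
  · intro k l s r h
    unfold lowerFamily
    split_ifs with h₁ h₂
    · rw [mm_eq_pathMonomial, mm_eq_pathMonomial]
      exact hl.qcomm_far h₁.1 h₁.2.2 (by unfold th; omega) (by unfold th; omega) h₂.2.2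
    all_goals first | exact QComm.zero_left _ _ _ | exact QComm.zero_right _ _ _

/-- The range of indices of the monomials `m_{θ(i+k)}^r`. -/
def lowerRange (n : ℕ) (i : ℤ) (k : ℕ) : Finset ℤ :=
  Finset.Icc (-th n (i + k)) (th n (i + k) - 1)

theorem lowerFamily_eq {n : ℕ} {i : ℤ} {k : ℕ} {r : ℤ} (h₁ : -th n (i + k) ≤ r)
    (h₂ : r < th n (i + k)) : lowerFamily n i k r = mm n (th n (i + k)) r :=
  if_pos ⟨by omega, h₁, h₂⟩

theorem Fv_eq_sum (n : ℕ) (i : ℤ) (k : ℕ) :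
    Fv n (i + k) = ∑ r ∈ lowerRange n i k, lowerFamily n i k r := by
  refine Finset.sum_congr rfl fun r hr => ?_
  rw [lowerRange, Finset.mem_Icc] at hr
  exact (lowerFamily_eq hr.1 (by omega)).symm

theorem FFaux_eq_sum (n : ℕ) {i : ℤ} (hi : 1 ≤ i) (k : ℕ) :
    FFaux n i k =
      ∑ r ∈ lowerRange n i k, fusedTerm (lowerRange n i) pathThreshold (lowerFamily n i) k r := by
  induction k with
  | zero =>
    have := Fv_eq_sum n i 0
    rwa [Nat.cast_zero, add_zero] at this
  | succ k ih =>
    rw [FFaux, ih, add_assoc, ← Nat.cast_succ, Fv_eq_sum,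
      (isPathFamily_lowerFamily n hi).sum_fusedTerm_succ qq_ne_zero qq_sub_inv_ne_zero]

theorem Fup_snd_eq {n : ℕ} {i j : ℤ} (hi : 1 ≤ i) (hij : i ≤ j) {s : ℤ}
    (hs : -th n (j + 1) ≤ s) (hs' : s < th n (j + 1)) :
    (Fup n i j s).2 =
      fusedUpper (lowerRange n i) pathThreshold (lowerFamily n i) (j - i).toNat s := by
  have hx := isPathFamily_lowerFamily n hi
  obtain ⟨k, rfl⟩ : ∃ k : ℕ, j = i + k := ⟨(j - i).toNat, by omega⟩
  rw [show (i + k - i).toNat = k by omega]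
  have hj : i + (k : ℤ) + 1 = i + ((k + 1 : ℕ) : ℤ) := by push_cast; ring
  have hu := hx.qcomm_fusedUpper (I := lowerRange n i) qq_ne_zero k (le_refl s)
  have hlow := hx.qcomm_fusedLower (I := lowerRange n i) qq_ne_zero k s
  rw [hj] at hs hs'
  rw [lowerFamily_eq hs hs'] at hu hlow
  simp only [QComm, zpow_one, zpow_neg] at hu hlow
  have hsum : FF n i (i + k) =
      fusedLower (lowerRange n i) pathThreshold (lowerFamily n i) k s +
        fusedUpper (lowerRange n i) pathThreshold (lowerFamily n i) k s := by
    rw [fusedLower_add_fusedUpper, ← FFaux_eq_sum n hi, FF, show (i + k - i).toNat = k by omega]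
  have hex : ∃ p : Dtorus n × Dtorus n, FF n i (i + k) = p.1 + p.2 ∧
      mm n (th n (i + k + 1)) s * p.1 = qq⁻¹ • (p.1 * mm n (th n (i + k + 1)) s) ∧
      mm n (th n (i + k + 1)) s * p.2 = qq • (p.2 * mm n (th n (i + k + 1)) s) := by
    rw [hj]
    exact ⟨(_, _), hsum, hlow, hu⟩
  unfold Fup decompPM
  rw [dif_pos hex]
  have hspec := hex.choose_spec
  simp only [hj] at hspec ⊢
  have hunit : IsUnit (mm n (th n (i + ((k + 1 : ℕ) : ℤ))) s) := by
    rw [mm_eq_pathMonomial]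
    exact isUnit_pathMonomial _ _ _ _
  exact eq_of_qcomm_decomposition qq_sub_inv_ne_zero hunit (hspec.1.symm.trans hsum) hspec.2.1
    hspec.2.2 hlow hu

theorem Fup_mul_mm_eq {n : ℕ} {i j : ℤ} (hi : 1 ≤ i) (hij : i ≤ j) {s : ℤ}
    (hs : -th n (j + 1) ≤ s) (hs' : s < th n (j + 1)) :
    (Fup n i j s).2 * mm n (th n (j + 1)) s =
      fusedTerm (lowerRange n i) pathThreshold (lowerFamily n i) ((j - i).toNat + 1) s := by
  rw [fusedTerm_succ, Fup_snd_eq hi hij hs hs']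
  have e : i + (((j - i).toNat + 1 : ℕ) : ℤ) = j + 1 := by omega
  rw [lowerFamily_eq, e]
  · rwa [e]
  · rwa [e]

theorem FgeS_eq_add (n : ℕ) (i j : ℤ) {s : ℤ} (hs : s < th n (j + 1)) :
    FgeS n i (j + 1) s =
      (Fup n i j s).2 * mm n (th n (j + 1)) s + FgeS n i (j + 1) (s + 1) := by
  unfold FgeS
  rw [← Finset.insert_Icc_add_one_left_eq_Icc (by omega : s ≤ th n (j + 1) - 1),
    Finset.sum_insert (by simp), add_sub_cancel_right]

theorem FF_relations {n : ℕ} {i j : ℤ} (hi : 1 ≤ i) (hij : i ≤ j) {s : ℤ}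
    (hs : -th n (j + 1) ≤ s) (hs' : s < th n (j + 1)) :
    QComm qq 1 (mm n (th n (j + 1)) s) (Fup n i j s).2 ∧
      QComm qq (-1) (mm n (th n (j + 1)) s) (FgeS n i (j + 1) (s + 1)) ∧
      QComm qq (-1) (Fup n i j s).2 (FgeS n i (j + 1) (s + 1)) := by
  have hx := isPathFamily_lowerFamily n hi
  have e : i + (((j - i).toNat + 1 : ℕ) : ℤ) = j + 1 := by omega
  have hm : mm n (th n (j + 1)) s = lowerFamily n i ((j - i).toNat + 1) s := by
    rw [lowerFamily_eq, e] <;> rwa [e]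
  have hg : FgeS n i (j + 1) (s + 1) = ∑ r ∈ Finset.Icc (s + 1) (th n (j + 1) - 1),
      fusedTerm (lowerRange n i) pathThreshold (lowerFamily n i) ((j - i).toNat + 1) r := by
    refine Finset.sum_congr rfl fun r hr => ?_
    rw [Finset.mem_Icc] at hr
    rw [add_sub_cancel_right, Fup_mul_mm_eq hi hij (by omega) (by omega)]
  rw [hg, hm, Fup_snd_eq hi hij hs hs']
  refine ⟨hx.qcomm_fusedUpper qq_ne_zero _ le_rfl, QComm.sum_right fun r hr => ?_,
    QComm.sum_right fun r hr => ?_⟩ <;> rw [Finset.mem_Icc] at hr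
  · exact hx.qcomm_fusedTerm_succ qq_ne_zero _ (by omega)
  · exact hx.qcomm_fusedUpper_fusedTerm_succ qq_ne_zero _ (by omega)
      (hx.qcomm_fusedTerm_same qq_ne_zero _)

section Pentagon

open PowerSeries Finset

variable {K B : Type*} [Field K] [Ring B] [Algebra K B]

theorem coeff_mul_of_vanishing {a b : ℕ} {p r : B⟦X⟧} (hp : ∀ d < a, coeff d p = 0)
    (hr : ∀ d < b, coeff d r = 0) : ∀ d < a + b, coeff d (p * r) = 0 := by
  intro d hd
  rw [coeff_mul]
  refine sum_eq_zero fun x hx => ?_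
  rw [HasAntidiagonal.mem_antidiagonal] at hx
  rcases lt_or_ge x.1 a with h | h
  · rw [hp _ h, zero_mul]
  · rw [hr _ (by omega), mul_zero]

theorem coeff_pow_of_vanishing {y : B⟦X⟧} (hy : ∀ d < 1, coeff d y = 0) (m : ℕ) :
    ∀ d < m, coeff d (y ^ m) = 0 := by
  induction m with
  | zero => simp
  | succ m ih =>
    rw [pow_succ]
    exact coeff_mul_of_vanishing ih hy

/-- The sum `∑ m, c m` of power series whose `m`-th term has order at least `m`. -/
def seriesSum (c : ℕ → B⟦X⟧) : B⟦X⟧ := .mk fun d => coeff d (∑ m ∈ range (d + 1), c m)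

theorem coeff_seriesSum {c : ℕ → B⟦X⟧} (hc : ∀ m, ∀ d < m, coeff d (c m) = 0) {d N : ℕ}
    (h : d < N) : coeff d (seriesSum c) = coeff d (∑ m ∈ range N, c m) := by
  rw [seriesSum, coeff_mk, map_sum, map_sum]
  refine sum_subset (range_subset_range.2 h) fun m _ hm => hc m d ?_
  rw [mem_range] at hm
  omega

theorem coeff_seriesSum_mul {c : ℕ → B⟦X⟧} (hc : ∀ m, ∀ d < m, coeff d (c m) = 0) (P : B⟦X⟧)
    {d N : ℕ} (h : d < N) : coeff d (seriesSum c * P) = coeff d ((∑ m ∈ range N, c m) * P) := by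
  rw [coeff_mul, coeff_mul]
  refine sum_congr rfl fun x hx => ?_
  rw [HasAntidiagonal.mem_antidiagonal] at hx
  rw [coeff_seriesSum (N := N) hc (by omega)]

theorem coeff_mul_seriesSum {c : ℕ → B⟦X⟧} (hc : ∀ m, ∀ d < m, coeff d (c m) = 0) (P : B⟦X⟧)
    {d N : ℕ} (h : d < N) : coeff d (P * seriesSum c) = coeff d (P * ∑ m ∈ range N, c m) := by
  rw [coeff_mul, coeff_mul]
  refine sum_congr rfl fun x hx => ?_
  rw [HasAntidiagonal.mem_antidiagonal] at hx
  rw [coeff_seriesSum (N := N) hc (by omega)]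

theorem seriesSum_mul_seriesSum {c e : ℕ → B⟦X⟧} (hc : ∀ m, ∀ d < m, coeff d (c m) = 0)
    (he : ∀ m, ∀ d < m, coeff d (e m) = 0) :
    seriesSum c * seriesSum e = seriesSum fun m => ∑ p ∈ antidiagonal m, c p.1 * e p.2 := by
  ext d
  rw [coeff_seriesSum_mul hc _ (Nat.lt_succ_self d), coeff_mul_seriesSum he _ (Nat.lt_succ_self d),
    seriesSum, coeff_mk, sum_mul_sum, ← sum_product', map_sum, map_sum]
  have h : ∀ m ∈ range (d + 1), coeff d (∑ p ∈ antidiagonal m, c p.1 * e p.2) =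
      ∑ p ∈ {p ∈ range (d + 1) ×ˢ range (d + 1) | p.1 + p.2 < d + 1} with p.1 + p.2 = m,
        coeff d (c p.1 * e p.2) := by
    intro m hm
    rw [map_sum]
    refine sum_congr ?_ fun _ _ => rfl
    ext p
    simp only [HasAntidiagonal.mem_antidiagonal, mem_filter, mem_product, mem_range] at hm ⊢
    omega
  rw [sum_congr rfl h, sum_fiberwise_of_maps_to fun p hp => mem_range.2 (mem_filter.1 hp).2]
  symm
  refine sum_subset (filter_subset _ _) fun p hp hp' => ?_
  rw [mem_filter, not_and] at hp'
  exact coeff_mul_of_vanishing (hc _) (he _) d (by have := hp' hp; omega)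

/-- The coefficients of the quantum dilogarithm series satisfy the recursion
`(q^{2(m+1)} - 1) a_{m+1} = -q a_m` with `a_0 = 1`. -/
structure IsDilogCoeff (q : K) (a : ℕ → K) : Prop where
  ne_zero : q ≠ 0
  pow_ne : ∀ m, q ^ (2 * (m + 1)) - 1 ≠ 0
  zero : a 0 = 1
  succ : ∀ m, (q ^ (2 * (m + 1)) - 1) * a (m + 1) = -q * a m

/-- The power series `∑ m, a m • y ^ m`. -/
def powerSum (a : ℕ → K) (y : B⟦X⟧) : B⟦X⟧ := seriesSum fun m => a m • y ^ m

theorem coeff_smul_pow_of_vanishing (a : ℕ → K) {y : B⟦X⟧} (hy : ∀ d < 1, coeff d y = 0) (m : ℕ) :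
    ∀ d < m, coeff d (a m • y ^ m) = 0 := fun d hd => by
  change a m • coeff d (y ^ m) = 0
  rw [coeff_pow_of_vanishing hy m d hd, smul_zero]

variable {q : K} {a : ℕ → K}

theorem powerSum_mul_of_semiconj {y z P : B⟦X⟧} (hy : ∀ d < 1, coeff d y = 0)
    (hz : ∀ d < 1, coeff d z = 0) (h : P * z = y * P) : P * powerSum a z = powerSum a y * P := by
  ext d
  have hy' := coeff_smul_pow_of_vanishing a hy
  have hz' := coeff_smul_pow_of_vanishing a hz
  rw [powerSum, powerSum, coeff_mul_seriesSum hz' _ (Nat.lt_succ_self d),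
    coeff_seriesSum_mul hy' _ (Nat.lt_succ_self d), mul_sum, sum_mul]
  congr 1
  refine sum_congr rfl fun m _ => ?_
  rw [mul_smul_comm, smul_mul_assoc, (SemiconjBy.pow_right h m : P * z ^ m = y ^ m * P)]

section

variable {R : Type*} [Ring R] [Algebra K R]

theorem QComm.pow_right_nat (hq : q ≠ 0) {e : ℤ} {x y : R} (h : QComm q e x y) (m : ℕ) :
    QComm q (e * m) x (y ^ m) := by
  induction m with
  | zero => simp [QComm]
  | succ m ih =>
    rw [pow_succ]
    have := ih.mul_right hq h
    rwa [show e * m + e = e * ((m + 1 : ℕ) : ℤ) by push_cast; ring] at this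

theorem IsDilogCoeff.add_pow (ha : IsDilogCoeff q a) {y z : R} (h : QComm q (-2) y z) (m : ℕ) :
    ∑ p ∈ antidiagonal m, (a p.1 • y ^ p.1) * (a p.2 • z ^ p.2) = a m • (y + z) ^ m := by
  have hq := ha.ne_zero
  induction m with
  | zero => simp [ha.zero]
  | succ m ih =>
    have hzy : ∀ k : ℕ, z * y ^ k = q ^ (2 * k) • (y ^ k * z) := fun k => by
      have := (h.symm hq).pow_right_nat hq k
      rw [neg_neg, QComm] at this
      exact_mod_cast this
    have h₁ : ∑ p ∈ antidiagonal (m + 1),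
        ((q ^ (2 * p.1) - 1) * a p.1 * a p.2) • (y ^ p.1 * z ^ p.2) =
        (-q) • (y * ∑ p ∈ antidiagonal m, (a p.1 • y ^ p.1) * (a p.2 • z ^ p.2)) := by
      rw [Nat.sum_antidiagonal_succ, mul_sum, smul_sum]
      simp only [mul_zero, pow_zero, sub_self, zero_mul, zero_smul, zero_add, ha.succ]
      refine sum_congr rfl fun p _ => ?_
      simp only [smul_mul_assoc, mul_smul_comm, smul_smul, pow_succ' y, mul_assoc]
      congr 1
      ring
    have h₂ : ∑ p ∈ antidiagonal (m + 1),
        (q ^ (2 * p.1) * a p.1 * ((q ^ (2 * p.2) - 1) * a p.2)) • (y ^ p.1 * z ^ p.2) =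
        (-q) • (z * ∑ p ∈ antidiagonal m, (a p.1 • y ^ p.1) * (a p.2 • z ^ p.2)) := by
      rw [Nat.sum_antidiagonal_succ', mul_sum, smul_sum]
      simp only [mul_zero, pow_zero, sub_self, zero_mul, zero_smul, zero_add, ha.succ]
      refine sum_congr rfl fun p _ => ?_
      simp only [smul_mul_assoc, mul_smul_comm, smul_smul, pow_succ' z, ← mul_assoc, hzy]
      congr 1
      ring
    have h₃ : (q ^ (2 * (m + 1)) - 1) •
        ∑ p ∈ antidiagonal (m + 1), (a p.1 • y ^ p.1) * (a p.2 • z ^ p.2) =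
        (q ^ (2 * (m + 1)) - 1) • (a (m + 1) • (y + z) ^ (m + 1)) := by
      rw [smul_smul, ha.succ, mul_smul, pow_succ', ← mul_smul_comm, ← ih, add_mul, smul_add, ← h₁,
        ← h₂, ← sum_add_distrib, smul_sum]
      refine sum_congr rfl fun p hp => ?_
      rw [HasAntidiagonal.mem_antidiagonal] at hp
      rw [← hp, smul_mul_assoc, mul_smul_comm, smul_smul, smul_smul, ← add_smul]
      congr 1
      ring
    exact smul_right_injective R (ha.pow_ne m) h₃

theorem IsDilogCoeff.sum_commutator (ha : IsDilogCoeff q a) {u v w : R}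
    (h : v * u - u * v = (q - q⁻¹) • w) (hw : QComm q (-2) w u) (N : ℕ) :
    v * ∑ m ∈ range (N + 1), a m • u ^ m + w * ∑ m ∈ range N, a m • u ^ m =
      (∑ m ∈ range (N + 1), a m • u ^ m) * v := by
  have hq := ha.ne_zero
  have hwu : ∀ m : ℕ, w * u ^ m = (q ^ (2 * m))⁻¹ • (u ^ m * w) := fun m => by
    have := hw.pow_right_nat hq m
    rw [QComm, neg_mul, zpow_neg] at this
    exact_mod_cast this
  have hvu : ∀ m : ℕ, v * u ^ (m + 1) =
      u ^ (m + 1) * v + (q * (1 - (q ^ (2 * (m + 1)))⁻¹)) • (u ^ m * w) := by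
    intro m
    induction m with
    | zero =>
      rw [sub_eq_iff_eq_add'] at h
      simp only [zero_add, pow_one, h, mul_one, pow_zero, one_mul]
      congr 2
      field_simp
    | succ m ih =>
      rw [sub_eq_iff_eq_add'] at h
      rw [pow_succ', ← mul_assoc, h, add_mul, mul_assoc, ih, smul_mul_assoc, hwu]
      simp only [mul_add, mul_smul_comm, ← mul_assoc, ← pow_succ']
      match_scalars <;> field_simp
      ring
  induction N with
  | zero => simp
  | succ N ih =>
    rw [sum_range_succ _ (N + 1), mul_add, add_mul, ← ih, sum_range_succ _ N, mul_add w,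
      smul_mul_assoc, mul_smul_comm, mul_smul_comm, hvu, hwu]
    have hs := ha.succ N
    have hk : a (N + 1) * (q * (1 - (q ^ (2 * (N + 1)))⁻¹)) + a N * (q ^ (2 * N))⁻¹ = 0 := by
      rw [show q ^ (2 * (N + 1)) = q ^ (2 * N) * q ^ 2 by ring] at hs ⊢
      field_simp
      linear_combination hs
    rw [smul_add, smul_smul, smul_smul]
    have : (a (N + 1) * (q * (1 - (q ^ (2 * (N + 1)))⁻¹))) • (u ^ N * w) +
        (a N * (q ^ (2 * N))⁻¹) • (u ^ N * w) = 0 := by rw [← add_smul, hk, zero_smul]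
    linear_combination (norm := skip) this
    abel

end

theorem IsDilogCoeff.powerSum_add (ha : IsDilogCoeff q a) {y z : B⟦X⟧}
    (hy : ∀ d < 1, coeff d y = 0) (hz : ∀ d < 1, coeff d z = 0) (h : QComm q (-2) y z) :
    powerSum a (y + z) = powerSum a y * powerSum a z := by
  unfold powerSum
  rw [seriesSum_mul_seriesSum (coeff_smul_pow_of_vanishing a hy) (coeff_smul_pow_of_vanishing a hz)]
  simp only [ha.add_pow h]

theorem IsDilogCoeff.add_mul_powerSum (ha : IsDilogCoeff q a) {u v w : B⟦X⟧}
    (hu : ∀ d < 1, coeff d u = 0) (h : v * u - u * v = (q - q⁻¹) • w) (hw : QComm q (-2) w u) :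
    powerSum a u * v = (v + w) * powerSum a u := by
  ext d
  have hu' := coeff_smul_pow_of_vanishing a hu
  rw [add_mul, map_add, powerSum, coeff_seriesSum_mul hu' _ (by omega : d < d + 1 + 1),
    coeff_mul_seriesSum hu' _ (by omega : d < d + 1 + 1),
    coeff_mul_seriesSum hu' _ (by omega : d < d + 1), ← map_add, ha.sum_commutator h hw]

/-- The pentagon identity, in a form with an additional summand `g`. -/
theorem IsDilogCoeff.pentagon (ha : IsDilogCoeff q a) {u v w g : B⟦X⟧}
    (hu : ∀ d < 1, coeff d u = 0) (hv : ∀ d < 1, coeff d v = 0) (hw : ∀ d < 1, coeff d w = 0)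
    (hg : ∀ d < 1, coeff d g = 0) (hvu : v * u - u * v = (q - q⁻¹) • w) (hvw : QComm q (-2) v w)
    (hwu : QComm q (-2) w u) (hwg : QComm q (-2) w g) (hug : Commute u g) :
    powerSum a v * powerSum a (w + g) * powerSum a u =
      powerSum a u * powerSum a v * powerSum a g := by
  have hvw' : ∀ d < 1, coeff d (v + w) = 0 := fun d hd => by rw [map_add, hv d hd, hw d hd, add_zero]
  have h₁ : powerSum a u * g = g * powerSum a u :=
    (powerSum_mul_of_semiconj hu hu hug.eq.symm).symm
  rw [ha.powerSum_add hw hg hwg, powerSum_mul_of_semiconj hvw' hv (ha.add_mul_powerSum hu hvu hwu),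
    ha.powerSum_add hv hw hvw, mul_assoc, mul_assoc, ← powerSum_mul_of_semiconj hg hg h₁]
  simp only [mul_assoc]

end Pentagon

section

open PowerSeries

/-- The coefficients of the quantum dilogarithm series. -/
def dilogCoeff (m : ℕ) : Kq := (-1) ^ m * qq ^ m / qfac m

theorem isDilogCoeff_dilogCoeff : IsDilogCoeff qq dilogCoeff := by
  have h : ∀ m : ℕ, qq ^ (2 * (m + 1)) - 1 ≠ 0 := fun m =>
    sub_ne_zero.2 (qq_pow_ne_one (by omega))
  refine ⟨qq_ne_zero, h, by simp [dilogCoeff, qfac], fun m => ?_⟩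
  have h₁ := h m
  have h₂ : qfac m ≠ 0 := Finset.prod_ne_zero_iff.2 fun l _ => h l
  have h₃ : qfac (m + 1) = qfac m * (qq ^ (2 * (m + 1)) - 1) := Finset.prod_range_succ _ _
  rw [dilogCoeff, dilogCoeff, h₃]
  field_simp
  ring

theorem monomial_pow_of_ring {B : Type*} [Ring B] (h : ℕ) (x : B) (m : ℕ) :
    monomial h x ^ m = monomial (h * m) (x ^ m) := by
  induction m with
  | zero => simp
  | succ m ih => rw [pow_succ, ih, monomial_mul_monomial, pow_succ, mul_add_one]

theorem coeff_monomial_of_lt_one {B : Type*} [Ring B] {h : ℕ} (hh : 0 < h) (x : B) :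
    ∀ d < 1, coeff d (monomial h x) = 0 := fun d hd => by
  rw [coeff_monomial, if_neg (by omega)]

variable {B : Type*} [Ring B] [Algebra Kq B]

theorem psiH_eq_powerSum {h : ℕ} (hh : 0 < h) (x : B) :
    psiH h x = powerSum dilogCoeff (monomial h x) := by
  ext d
  have hc : ∀ m : ℕ, coeff d (dilogCoeff m • monomial h x ^ m) =
      if d = h * m then dilogCoeff m • x ^ m else 0 := fun m => by
    rw [monomial_pow_of_ring]
    change dilogCoeff m • coeff d (monomial (h * m) (x ^ m)) = _
    rw [coeff_monomial, smul_ite, smul_zero]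
  rw [psiH, powerSum, seriesSum, coeff_mk, coeff_mk, map_sum, Finset.sum_congr rfl fun m _ => hc m]
  split_ifs with hd
  · obtain ⟨m, rfl⟩ := hd.2
    rw [Nat.mul_div_cancel_left _ hh, Finset.sum_eq_single m, if_pos rfl, dilogCoeff]
    · intro l _ hl
      exact if_neg fun h' => hl (Nat.eq_of_mul_eq_mul_left hh h').symm
    · intro hm
      exact absurd (Finset.mem_range.2 (Nat.lt_succ_of_le (Nat.le_mul_of_pos_left m hh))) hm
  · symm
    refine Finset.sum_eq_zero fun m _ => if_neg fun h' => hd ⟨hh, ⟨m, h'⟩⟩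

theorem psiH_pentagon {h : ℕ} (hh : 0 < h) {U V W G : B} (hvu : V * U - U * V = (qq - qq⁻¹) • W)
    (hvw : QComm qq (-2) V W) (hwu : QComm qq (-2) W U) (hwg : QComm qq (-2) W G)
    (hug : Commute U G) :
    psiH h V * psiH (h + 1) (W + G) * psiH 1 U = psiH 1 U * psiH h V * psiH (h + 1) G := by
  have hsmul : ∀ (c : Kq) (n : ℕ) (x : B), c • monomial n x = monomial n (c • x) := fun c n x => by
    ext d
    change c • coeff d (monomial n x) = _
    rw [coeff_monomial, coeff_monomial, smul_ite, smul_zero]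
  have hq : ∀ {k l : ℕ} {x y : B}, QComm qq (-2) x y →
      QComm qq (-2) (monomial k x) (monomial l y) := fun {k l x y} hxy => by
    rw [QComm, monomial_mul_monomial, monomial_mul_monomial, hsmul, add_comm k l, hxy]
  rw [psiH_eq_powerSum hh, psiH_eq_powerSum (Nat.add_pos_left hh 1), psiH_eq_powerSum one_pos,
    psiH_eq_powerSum (Nat.add_pos_left hh 1), map_add]
  refine isDilogCoeff_dilogCoeff.pentagon (coeff_monomial_of_lt_one one_pos U)
    (coeff_monomial_of_lt_one hh V) (coeff_monomial_of_lt_one (Nat.add_pos_left hh 1) W)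
    (coeff_monomial_of_lt_one (Nat.add_pos_left hh 1) G) ?_ (hq hvw) (hq hwu) (hq hwg) ?_
  · rw [monomial_mul_monomial, monomial_mul_monomial, add_comm 1 h, ← map_sub, hvu, hsmul]
  · rw [Commute, SemiconjBy, monomial_mul_monomial, monomial_mul_monomial, hug.eq, add_comm]

end

section TensorRelations

open scoped TensorProduct

variable {K D : Type*} [Field K] [Ring D] [Algebra K D] {q : K}

theorem QComm.tmul (hq : q ≠ 0) {e f g : ℤ} {x y z w : D} (h : QComm q e x y)
    (h' : QComm q f z w) (hg : e + f = g) : QComm q g (x ⊗ₜ[K] z) (y ⊗ₜ[K] w) := by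
  unfold QComm at *
  rw [Algebra.TensorProduct.tmul_mul_tmul, Algebra.TensorProduct.tmul_mul_tmul, h, h',
    TensorProduct.smul_tmul_smul, ← hg, zpow_add₀ hq]

theorem tmul_commutator {a b c f m : D} (hμ : q - q⁻¹ ≠ 0)
    (hc : c = (q - q⁻¹)⁻¹ • (a * b - q • (b * a))) (hmf : QComm q 1 m f) :
    (a ⊗ₜ[K] f) * (b ⊗ₜ[K] m) - (b ⊗ₜ[K] m) * (a ⊗ₜ[K] f) = (q - q⁻¹) • (c ⊗ₜ[K] (f * m)) := by
  rw [QComm, zpow_one] at hmf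
  rw [Algebra.TensorProduct.tmul_mul_tmul, Algebra.TensorProduct.tmul_mul_tmul, hmf, hc,
    TensorProduct.smul_tmul', smul_smul, mul_inv_cancel₀ hμ, one_smul, TensorProduct.sub_tmul,
    TensorProduct.tmul_smul, TensorProduct.smul_tmul']

end TensorRelations

/-- The pentagon-type identity
`ψ_{j−i+1}(E_{i,j} ⊗ F_{i,j}^{↑s_+}) ψ_{j−i+2}(E_{i,j+1} ⊗ F_{i,j+1}^{≥s}) ψ_1(E_{j+1} ⊗ m_{θ(j+1)}^s)
 = ψ_1(E_{j+1} ⊗ m_{θ(j+1)}^s) ψ_{j−i+1}(E_{i,j} ⊗ F_{i,j}^{↑s_+}) ψ_{j−i+2}(E_{i,j+1} ⊗ F_{i,j+1}^{≥s+1})`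
in `(𝒟ₙ ⊗ 𝒟ₙ)⟦t⟧`. -/
theorem statement12 (n : ℕ) (hn : 1 ≤ n) (i j s : ℤ)
    (h1 : 1 ≤ i) (hij : i ≤ j) (hj : j ≤ (n : ℤ) - 1)
    (hs1 : -(th n (j + 1)) ≤ s) (hs2 : s ≤ th n (j + 1) - 1) :
    psiH (B := AA n) ((j - i + 1).toNat) ((EE n i j) ⊗ₜ[Kq] (Fup n i j s).2)
        * psiH ((j - i + 2).toNat) ((EE n i (j + 1)) ⊗ₜ[Kq] FgeS n i (j + 1) s)
        * psiH 1 ((Ev n (j + 1)) ⊗ₜ[Kq] mm n (th n (j + 1)) s)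
      = psiH 1 ((Ev n (j + 1)) ⊗ₜ[Kq] mm n (th n (j + 1)) s)
        * psiH ((j - i + 1).toNat) ((EE n i j) ⊗ₜ[Kq] (Fup n i j s).2)
        * psiH ((j - i + 2).toNat) ((EE n i (j + 1)) ⊗ₜ[Kq] FgeS n i (j + 1) (s + 1)) := by
  have hs : s < th n (j + 1) := by omega
  have hq := qq_ne_zero
  have refl : ∀ x : Dtorus n, QComm qq 0 x x := fun x => by simp [QComm]
  obtain ⟨hac, hcb⟩ := EE_relations (n := n) h1 hij (by omega)
  obtain ⟨hmf, hmg, hfg⟩ := FF_relations h1 hij hs1 hs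
  have hff : QComm qq (-1) (Fup n i j s).2 ((Fup n i j s).2 * mm n (th n (j + 1)) s) :=
    (refl _).mul_right hq (hmf.symm hq)
  have hfm : QComm qq (-1) ((Fup n i j s).2 * mm n (th n (j + 1)) s) (mm n (th n (j + 1)) s) :=
    (hmf.symm hq).mul_left hq (refl _)
  have hfmg : QComm qq (-2) ((Fup n i j s).2 * mm n (th n (j + 1)) s) (FgeS n i (j + 1) (s + 1)) :=
    hfg.mul_left hq hmg
  have hbc : QComm qq 0 (Ev n (j + 1) ⊗ₜ[Kq] mm n (th n (j + 1)) s)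
      (EE n i (j + 1) ⊗ₜ[Kq] FgeS n i (j + 1) (s + 1)) := (hcb.symm hq).tmul hq hmg (by norm_num)
  rw [QComm, zpow_zero, one_smul] at hbc
  rw [FgeS_eq_add n i j hs, TensorProduct.tmul_add,
    show (j - i + 2).toNat = (j - i + 1).toNat + 1 by omega]
  exact psiH_pentagon (h := (j - i + 1).toNat) (by omega)
    (tmul_commutator qq_sub_inv_ne_zero (EE_succ n hij) hmf)
    (hac.tmul hq hff (by norm_num)) (hcb.tmul hq hfm (by norm_num))
    ((refl _).tmul hq hfmg (by norm_num)) hbc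

end
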